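/- arXiv:2512.00348 — 3 statements merged into one kernel-verified Lean document; each statement's English description precedes it below -/
import Mathlib

section
/- Let A ⊆ ℕ^n be a nonempty finite set. An extreme ray r = ℝ₊·f of the SONC cone C(A) is exposed if there exists a linear functional l on the space of polynomials supported on A such that l(f) = 0 and l(g) > 0 for every generator g of every extreme ray q = ℝ₊·g of C(A) other than r. -/
open MvPolynomial Finset

/-- A lattice exponent is even if every entry is even. -/
def IsEvenPt {n : ℕ} (α : Fin n →₀ ℕ) : Prop := ∀ i, Even (α i)

/-- The embedding of a lattice exponent into `ℝⁿ`. -/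
def toR {n : ℕ} (α : Fin n →₀ ℕ) : Fin n → ℝ := fun i => (α i : ℝ)

/-- `(S, β)` is a (simplicial) circuit on the ground set `A`:
`S ⊆ A ∩ (2ℕ)ⁿ` is affinely independent and `β ∈ A` lies in the relative
interior of `conv S`. -/
structure IsCircuitOn {n : ℕ} (A : Finset (Fin n →₀ ℕ)) (S : Finset (Fin n →₀ ℕ))
    (β : Fin n →₀ ℕ) : Prop where
  subset : S ⊆ A
  even_mem : ∀ α ∈ S, IsEvenPt α
  beta_mem : β ∈ A
  indep : AffineIndependent ℝ (fun α : S => toR (α : Fin n →₀ ℕ))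
  relint : toR β ∈ intrinsicInterior ℝ (convexHull ℝ (toR '' (S : Set (Fin n →₀ ℕ))))

/-- `lam` gives the barycentric coordinates of `β` with respect to `S`. -/
def IsBarycentric {n : ℕ} (S : Finset (Fin n →₀ ℕ)) (β : Fin n →₀ ℕ)
    (lam : (Fin n →₀ ℕ) → ℝ) : Prop :=
  (∀ α ∈ S, 0 < lam α) ∧ ∑ α ∈ S, lam α = 1 ∧
    ∀ i, (β i : ℝ) = ∑ α ∈ S, lam α * (α i : ℝ)

/-- The circuit number `Θ = ∏_{α ∈ S} (c_α / λ_α) ^ (λ_α)`. -/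
noncomputable def circuitNumber {n : ℕ} (S : Finset (Fin n →₀ ℕ))
    (c lam : (Fin n →₀ ℕ) → ℝ) : ℝ :=
  ∏ α ∈ S, (c α / lam α) ^ (lam α)

/-- The circuit polynomial `∑_{α ∈ S} c_α x^α + d x^β`. -/
noncomputable def circuitPoly {n : ℕ} (S : Finset (Fin n →₀ ℕ)) (β : Fin n →₀ ℕ)
    (c : (Fin n →₀ ℕ) → ℝ) (d : ℝ) : MvPolynomial (Fin n) ℝ :=
  (∑ α ∈ S, monomial α (c α)) + monomial β d

/-- Generators of the SONC cone on `A`: nonnegative circuit polynomials on circuits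
on `A`, together with monomial squares `x^α`, `α ∈ A ∩ (2ℕ)ⁿ`. -/
def SONCGen {n : ℕ} (A : Finset (Fin n →₀ ℕ)) : Set (MvPolynomial (Fin n) ℝ) :=
  {f | (∃ S β c d, IsCircuitOn A S β ∧ (∀ α ∈ S, 0 < c α) ∧
          f = circuitPoly S β c d ∧ ∀ x : Fin n → ℝ, 0 ≤ eval x f) ∨
       (∃ α ∈ A, IsEvenPt α ∧ f = monomial α 1)}

/-- The SONC cone on `A`: all finite nonnegative combinations of the generators. -/
def SONCCone {n : ℕ} (A : Finset (Fin n →₀ ℕ)) : Set (MvPolynomial (Fin n) ℝ) :=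
  {f | ∃ (k : ℕ) (g : Fin k → MvPolynomial (Fin n) ℝ) (μ : Fin k → ℝ),
        (∀ i, g i ∈ SONCGen A ∧ 0 ≤ μ i) ∧ f = ∑ i, μ i • g i}

/-- The ray `ℝ₊ · f`. -/
def raySet {n : ℕ} (f : MvPolynomial (Fin n) ℝ) : Set (MvPolynomial (Fin n) ℝ) :=
  {p | ∃ t : ℝ, 0 ≤ t ∧ p = t • f}

/-- `ℝ₊ · f` is an extreme ray of the convex cone `K`. -/
def IsExtremeRay {n : ℕ} (K : Set (MvPolynomial (Fin n) ℝ))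
    (f : MvPolynomial (Fin n) ℝ) : Prop :=
  f ≠ 0 ∧ f ∈ K ∧ ∀ g h, g ∈ K → h ∈ K → f = g + h → g ∈ raySet f ∧ h ∈ raySet f

/-- The ray `ℝ₊ · f` is an exposed face of `K`: some linear functional vanishes on
the ray and is strictly positive on the rest of `K`. -/
def IsExposedRay {n : ℕ} (K : Set (MvPolynomial (Fin n) ℝ))
    (f : MvPolynomial (Fin n) ℝ) : Prop :=
  ∃ l : MvPolynomial (Fin n) ℝ →ₗ[ℝ] ℝ,
    (∀ p ∈ raySet f, l p = 0) ∧ ∀ g ∈ K \ raySet f, 0 < l g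

/-- `(S, β)` is a reduced circuit on `A`: the only even points of `A` in `conv S`
are those of `S ∪ {β}`. -/
def IsReducedCircuitOn {n : ℕ} (A : Finset (Fin n →₀ ℕ)) (S : Finset (Fin n →₀ ℕ))
    (β : Fin n →₀ ℕ) : Prop :=
  IsCircuitOn A S β ∧
    {γ : Fin n →₀ ℕ | γ ∈ A ∧ IsEvenPt γ ∧
        toR γ ∈ convexHull ℝ (toR '' (S : Set (Fin n →₀ ℕ)))} =
      {γ : Fin n →₀ ℕ | (γ ∈ S ∨ γ = β) ∧ IsEvenPt γ}

theorem toR_injective {n : ℕ} : Function.Injective (toR (n := n)) := fun α β h => by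
  ext i
  exact Nat.cast_injective (R := ℝ) (congrFun h i)

/-- A vertex of an affinely independent set is separated from the remaining ones by an affine
function taking the values `1` and `0`. -/
theorem exists_affineMap_eq_one_eq_zero {E : Type*} [NormedAddCommGroup E] [NormedSpace ℝ E]
    {s : Set E} (hs : AffineIndependent ℝ ((↑) : s → E)) {x : E} (hx : x ∈ s) :
    ∃ h : E →ᵃ[ℝ] ℝ, h x = 1 ∧ ∀ y ∈ s, y ≠ x → h y = 0 := by
  obtain ⟨t, hst, ht, htop⟩ := exists_subset_affineIndependent_affineSpan_eq_top hs
  let b : AffineBasis t ℝ E := ⟨(↑), ht, by simpa using htop⟩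
  refine ⟨b.coord ⟨x, hst hx⟩, b.coord_apply_eq ⟨x, hst hx⟩, fun y hy hyx => ?_⟩
  exact b.coord_apply_ne (i := ⟨x, hst hx⟩) (j := ⟨y, hst hy⟩)
    fun h => hyx (congrArg Subtype.val h).symm

/-- A point of the relative interior can be moved slightly away from any point of the set. -/
theorem exists_lineMap_mem_of_mem_intrinsicInterior {E : Type*} [NormedAddCommGroup E]
    [NormedSpace ℝ E] {s : Set E} {x y : E} (hy : y ∈ intrinsicInterior ℝ s) (hx : x ∈ s) :
    ∃ t : ℝ, 1 < t ∧ AffineMap.lineMap x y t ∈ s := by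
  obtain ⟨y', hy', rfl⟩ := mem_intrinsicInterior.1 hy
  let x' : affineSpan ℝ s := ⟨x, subset_affineSpan ℝ s hx⟩
  have hmem : ∀ t : ℝ, AffineMap.lineMap x (y' : E) t ∈ affineSpan ℝ s := fun t =>
    AffineMap.lineMap_mem t x'.2 y'.2
  have hcont : Continuous fun t : ℝ =>
      (⟨AffineMap.lineMap x (y' : E) t, hmem t⟩ : affineSpan ℝ s) :=
    (AffineMap.lineMap_continuous).subtype_mk _
  have hnhds : ∀ᶠ t in nhds (1 : ℝ), AffineMap.lineMap x (y' : E) t ∈ s := by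
    have h1 : interior ((↑) ⁻¹' s : Set (affineSpan ℝ s)) ∈
        nhds (⟨AffineMap.lineMap x (y' : E) (1 : ℝ), hmem 1⟩ : affineSpan ℝ s) := by
      refine isOpen_interior.mem_nhds ?_
      convert hy'
      simp
    filter_upwards [hcont.continuousAt.eventually h1] with t ht
    exact interior_subset (s := ((↑) ⁻¹' s : Set (affineSpan ℝ s))) ht
  obtain ⟨t, ht, ht1⟩ := ((hnhds.filter_mono nhdsWithin_le_nhds).and
    (self_mem_nhdsWithin (a := (1 : ℝ)) (s := Set.Ioi 1))).exists
  exact ⟨t, ht1, ht⟩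

/-- A relative interior point of a simplex lies on no proper face. -/
theorem IsCircuitOn.notMem_convexHull {n : ℕ} {A S T : Finset (Fin n →₀ ℕ)} {β : Fin n →₀ ℕ}
    (h : IsCircuitOn A S β) (hT : T ⊂ S) :
    toR β ∉ convexHull ℝ (toR '' (T : Set (Fin n →₀ ℕ))) := by
  intro hβ
  obtain ⟨α, hαS, hαT⟩ := Finset.exists_of_ssubset hT
  have hind : AffineIndependent ℝ ((↑) : (toR '' (S : Set (Fin n →₀ ℕ))) → Fin n → ℝ) := by
    have := h.indep.range
    convert this <;> simp [Set.image_eq_range]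
  obtain ⟨u, hu1, hu0⟩ := exists_affineMap_eq_one_eq_zero hind
    (Set.mem_image_of_mem _ (Finset.mem_coe.2 hαS))
  have hnonneg : ∀ y ∈ convexHull ℝ (toR '' (S : Set (Fin n →₀ ℕ))), 0 ≤ u y := by
    intro y hy
    refine convexHull_min (t := u ⁻¹' Set.Ici 0) ?_ ((convex_Ici 0).affine_preimage u) hy
    rintro z hz
    by_cases hzα : z = toR α
    · simp [hzα, hu1]
    · simp [hu0 z hz hzα]
  have hzero : u (toR β) = 0 := by
    refine convexHull_min (t := u ⁻¹' {0}) ?_ ((convex_singleton 0).affine_preimage u) hβ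
    rintro _ ⟨γ, hγ, rfl⟩
    exact hu0 _ ⟨γ, hT.subset hγ, rfl⟩ fun hγα => hαT (toR_injective hγα ▸ hγ)
  obtain ⟨t, ht, hmem⟩ := exists_lineMap_mem_of_mem_intrinsicInterior h.relint
    (subset_convexHull ℝ _ (Set.mem_image_of_mem _ (Finset.mem_coe.2 hαS)))
  have := hnonneg _ hmem
  rw [AffineMap.apply_lineMap, hu1, hzero, AffineMap.lineMap_apply_ring] at this
  linarith

theorem prod_exp_mul_pow {n : ℕ} (σ v : Fin n → ℝ) (t : ℝ) (α : Fin n →₀ ℕ) :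
    α.prod (fun i e => (σ i * Real.exp (t * v i)) ^ e) =
      (∏ i, σ i ^ α i) * Real.exp (t * ∑ i, v i * toR α i) := by
  rw [Finsupp.prod_fintype _ _ (fun _ => pow_zero _)]
  simp_rw [mul_pow, Finset.prod_mul_distrib, Finset.mul_sum, Real.exp_sum, ← Real.exp_nat_mul]
  congr 1
  refine Finset.prod_congr rfl fun i _ => ?_
  simp only [toR]
  ring_nf

/-- The coefficient at an exponent outside the convex hull of the others dominates along a
suitable curve, in every orthant. -/
theorem sign_mul_coeff_nonneg {n : ℕ} {T : Finset (Fin n →₀ ℕ)} {β : Fin n →₀ ℕ}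
    (hβ : toR β ∉ convexHull ℝ (toR '' (T : Set (Fin n →₀ ℕ)))) {c : (Fin n →₀ ℕ) → ℝ} {d : ℝ}
    (hpos : ∀ x, 0 ≤ eval x (circuitPoly T β c d)) (σ : Fin n → ℝ) :
    0 ≤ (∏ i, σ i ^ β i) * d := by
  obtain ⟨u, s, hus, hsu⟩ := geometric_hahn_banach_closed_point (convex_convexHull ℝ _)
    ((T.finite_toSet.image toR).isCompact_convexHull (𝕜 := ℝ)).isClosed hβ
  set v : Fin n → ℝ := fun i => u (Pi.single i 1)
  have hv : ∀ y, ∑ i, v i * y i = u y := fun y => by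
    conv_rhs => rw [pi_eq_sum_univ' y, map_sum]
    refine Finset.sum_congr rfl fun i _ => ?_
    rw [map_smul, smul_eq_mul, mul_comm]
  have hlim : Filter.Tendsto (fun t : ℝ => (∑ α ∈ T, c α * (∏ i, σ i ^ α i) *
      Real.exp (t * (u (toR α) - u (toR β)))) + (∏ i, σ i ^ β i) * d) Filter.atTop
      (nhds ((∑ α ∈ T, c α * (∏ i, σ i ^ α i) * 0) + (∏ i, σ i ^ β i) * d)) := by
    refine (tendsto_finsetSum _ fun α hα => Filter.Tendsto.const_mul _ ?_).add_const _
    refine Real.tendsto_exp_atBot.comp (Filter.tendsto_id.atTop_mul_const_of_neg ?_)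
    linarith [hus _ (subset_convexHull ℝ _ (Set.mem_image_of_mem _ (Finset.mem_coe.2 hα)))]
  simp only [mul_zero, Finset.sum_const_zero, zero_add] at hlim
  refine ge_of_tendsto' hlim fun t => ?_
  have h := mul_nonneg (hpos fun i => σ i * Real.exp (t * v i))
    (Real.exp_pos (-(t * u (toR β)))).le
  simp only [circuitPoly, map_add, map_sum, eval_monomial, prod_exp_mul_pow, hv, add_mul,
    Finset.sum_mul] at h
  convert h using 2
  · refine Finset.sum_congr rfl fun α _ => ?_
    rw [mul_sub, sub_eq_add_neg, Real.exp_add]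
    ring
  · rw [mul_assoc, mul_assoc, ← Real.exp_add]
    simp [mul_comm]

theorem SONCCone.zero_mem {n : ℕ} (A : Finset (Fin n →₀ ℕ)) : 0 ∈ SONCCone A :=
  ⟨0, Fin.elim0, Fin.elim0, fun i => i.elim0, by simp⟩

theorem SONCCone.add_mem {n : ℕ} {A : Finset (Fin n →₀ ℕ)} {p q : MvPolynomial (Fin n) ℝ}
    (hp : p ∈ SONCCone A) (hq : q ∈ SONCCone A) : p + q ∈ SONCCone A := by
  obtain ⟨k, g, μ, hg, rfl⟩ := hp
  obtain ⟨m, g', μ', hg', rfl⟩ := hq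
  refine ⟨k + m, Fin.append g g', Fin.append μ μ', fun i => ?_, by simp [Fin.sum_univ_add]⟩
  refine Fin.addCases (fun i => ?_) (fun i => ?_) i
  · simpa using hg i
  · simpa using hg' i

theorem SONCCone.smul_mem {n : ℕ} {A : Finset (Fin n →₀ ℕ)} {p : MvPolynomial (Fin n) ℝ}
    (hp : p ∈ SONCCone A) {t : ℝ} (ht : 0 ≤ t) : t • p ∈ SONCCone A := by
  obtain ⟨k, g, μ, hg, rfl⟩ := hp
  exact ⟨k, g, fun i => t * μ i, fun i => ⟨(hg i).1, mul_nonneg ht (hg i).2⟩,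
    by simp [Finset.smul_sum, mul_smul]⟩

theorem SONCCone.sum_mem {n : ℕ} {A : Finset (Fin n →₀ ℕ)} {ι : Type*} {s : Finset ι}
    {p : ι → MvPolynomial (Fin n) ℝ} (hp : ∀ i ∈ s, p i ∈ SONCCone A) :
    ∑ i ∈ s, p i ∈ SONCCone A :=
  Finset.sum_induction _ (· ∈ SONCCone A) (fun _ _ => SONCCone.add_mem) (SONCCone.zero_mem A) hp

theorem SONCGen.mem_cone {n : ℕ} {A : Finset (Fin n →₀ ℕ)} {p : MvPolynomial (Fin n) ℝ}
    (hp : p ∈ SONCGen A) : p ∈ SONCCone A :=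
  ⟨1, fun _ => p, fun _ => 1, fun _ => ⟨hp, zero_le_one⟩, by simp⟩

theorem SONCCone.monomial_mem {n : ℕ} {A : Finset (Fin n →₀ ℕ)} {α : Fin n →₀ ℕ} (hα : α ∈ A)
    (heven : IsEvenPt α) {t : ℝ} (ht : 0 ≤ t) : monomial α t ∈ SONCCone A := by
  have h := SONCCone.smul_mem (SONCGen.mem_cone (A := A) (Or.inr ⟨α, hα, heven, rfl⟩)) ht
  simpa [smul_monomial] using h

theorem SONCCone.eval_nonneg {n : ℕ} {A : Finset (Fin n →₀ ℕ)} {p : MvPolynomial (Fin n) ℝ}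
    (hp : p ∈ SONCCone A) (x : Fin n → ℝ) : 0 ≤ eval x p := by
  obtain ⟨k, g, μ, hg, rfl⟩ := hp
  rw [map_sum]
  refine Finset.sum_nonneg fun i _ => ?_
  rw [smul_eval]
  refine mul_nonneg (hg i).2 ?_
  rcases (hg i).1 with ⟨S, β, c, d, -, -, -, h⟩ | ⟨α, -, heven, h⟩
  · exact h x
  · rw [h, eval_monomial, one_mul, Finsupp.prod]
    exact Finset.prod_nonneg fun j _ => (heven j).pow_nonneg _

/-- Nonnegative limits of circuit polynomials, where some of the vertex coefficients may vanish,
still lie in the SONC cone. -/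
theorem IsCircuitOn.circuitPoly_mem_cone {n : ℕ} {A S : Finset (Fin n →₀ ℕ)} {β : Fin n →₀ ℕ}
    (h : IsCircuitOn A S β) {c : (Fin n →₀ ℕ) → ℝ} {d : ℝ} (hc : ∀ α ∈ S, 0 ≤ c α)
    (hpos : ∀ x, 0 ≤ eval x (circuitPoly S β c d)) : circuitPoly S β c d ∈ SONCCone A := by
  classical
  have hT : circuitPoly S β c d = circuitPoly (S.filter fun α => 0 < c α) β c d := by
    unfold circuitPoly
    congr 1
    refine (Finset.sum_filter_of_ne fun α hα hne => (hc α hα).lt_of_ne fun h0 => hne ?_).symm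
    rw [← h0, monomial_zero]
  rcases (Finset.filter_subset (fun α => 0 < c α) S).eq_or_ssubset with hS | hS
  · exact SONCGen.mem_cone (Or.inl ⟨S, β, c, d, h, Finset.filter_eq_self.1 hS, rfl, hpos⟩)
  · have hsign := sign_mul_coeff_nonneg (h.notMem_convexHull hS) (fun x => hT ▸ hpos x)
    have hd : 0 ≤ d := by simpa using hsign fun _ => 1
    refine SONCCone.add_mem (SONCCone.sum_mem fun α hα =>
      SONCCone.monomial_mem (h.subset hα) (h.even_mem α hα) (hc α hα)) ?_
    by_cases hβ : IsEvenPt β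
    · exact SONCCone.monomial_mem h.beta_mem hβ hd
    · obtain ⟨i, hi⟩ := not_forall.1 hβ
      have hd' : 0 ≤ -d := by
        have := hsign fun j => if j = i then -1 else 1
        simpa [ite_pow, Finset.prod_ite_eq', (Nat.not_even_iff_odd.1 hi).neg_one_pow] using this
      rw [show d = 0 by linarith, monomial_zero]
      exact SONCCone.zero_mem A

/-- The polynomial supported on `A` with prescribed coefficients. -/
noncomputable def ofCoeffs {n : ℕ} (A : Finset (Fin n →₀ ℕ)) :
    (A → ℝ) →ₗ[ℝ] MvPolynomial (Fin n) ℝ :=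
  Fintype.linearCombination ℝ fun α : A => monomial (α : Fin n →₀ ℕ) (1 : ℝ)

open Classical in
theorem coeff_ofCoeffs {n : ℕ} (A : Finset (Fin n →₀ ℕ)) (w : A → ℝ) (m : Fin n →₀ ℕ) :
    coeff m (ofCoeffs A w) = if h : m ∈ A then w ⟨m, h⟩ else 0 := by
  simp only [ofCoeffs, Fintype.linearCombination_apply, coeff_sum, coeff_smul, coeff_monomial,
    smul_eq_mul, mul_ite, mul_one, mul_zero]
  split_ifs with h
  · rw [Finset.sum_eq_single ⟨m, h⟩] <;> simp +contextual [Subtype.ext_iff]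
  · exact Finset.sum_eq_zero fun α _ => if_neg fun hα : (α : Fin n →₀ ℕ) = m => h (hα ▸ α.2)

theorem ofCoeffs_injective {n : ℕ} (A : Finset (Fin n →₀ ℕ)) :
    Function.Injective (ofCoeffs A) := fun w w' h => by
  ext α
  simpa [coeff_ofCoeffs] using congrArg (coeff (α : Fin n →₀ ℕ)) h

theorem ofCoeffs_coeff {n : ℕ} {A : Finset (Fin n →₀ ℕ)} {p : MvPolynomial (Fin n) ℝ}
    (hp : ∀ m ∉ A, coeff m p = 0) : ofCoeffs A (fun α => coeff (α : Fin n →₀ ℕ) p) = p := by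
  ext m
  rw [coeff_ofCoeffs]
  split_ifs with h
  · rfl
  · exact (hp m h).symm

/-- Finitely many evaluations determine a polynomial supported on `A`. -/
theorem exists_finset_eval_injective {n : ℕ} (A : Finset (Fin n →₀ ℕ)) :
    ∃ X : Finset (Fin n → ℝ), ∀ w, (∀ x ∈ X, eval x (ofCoeffs A w) = 0) → w = 0 := by
  classical
  set D := A.sup fun α => Finset.univ.sup α
  refine ⟨Fintype.piFinset fun _ => (Finset.range (D + 1)).image (Nat.cast : ℕ → ℝ),
    fun w hw => ofCoeffs_injective A ?_⟩
  rw [map_zero]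
  refine eq_zero_of_eval_zero_at_prod_finset _
    (fun _ => (Finset.range (D + 1)).image (Nat.cast : ℕ → ℝ)) (fun i => ?_)
    fun x hx => hw x (Fintype.mem_piFinset.2 hx)
  rw [Finset.card_image_of_injective _ Nat.cast_injective, Finset.card_range,
    degreeOf_lt_iff D.succ_pos]
  intro m hm
  have hmA : m ∈ A := by
    by_contra h
    simp [coeff_ofCoeffs, h] at hm
  exact Nat.lt_succ_of_le ((Finset.le_sup (f := m) (Finset.mem_univ i)).trans
    (Finset.le_sup (f := fun α : Fin n →₀ ℕ => Finset.univ.sup α) hmA))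

/-- Evaluation at a point, as a linear functional of the coefficients. -/
noncomputable def evalCoeffs {n : ℕ} (A : Finset (Fin n →₀ ℕ)) (x : Fin n → ℝ) :
    (A → ℝ) →ₗ[ℝ] ℝ :=
  (aeval x).toLinearMap ∘ₗ ofCoeffs A

theorem evalCoeffs_apply {n : ℕ} (A : Finset (Fin n →₀ ℕ)) (x : Fin n → ℝ) (w : A → ℝ) :
    evalCoeffs A x w = eval x (ofCoeffs A w) := by
  simp [evalCoeffs]

/-- The closed cone of coefficient vectors of nonnegative polynomials on the circuit `(S, β)`. -/
def circuitCone {n : ℕ} (A S : Finset (Fin n →₀ ℕ)) (β : Fin n →₀ ℕ) : AddSubmonoid (A → ℝ) where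
  carrier := {w | (∀ α : A, (α : Fin n →₀ ℕ) ∈ S → (α : Fin n →₀ ℕ) ≠ β → 0 ≤ w α) ∧
    (∀ α : A, (α : Fin n →₀ ℕ) ∉ S → (α : Fin n →₀ ℕ) ≠ β → w α = 0) ∧
    ∀ x, 0 ≤ evalCoeffs A x w}
  zero_mem' := by simp
  add_mem' := by
    rintro v w ⟨hv1, hv2, hv3⟩ ⟨hw1, hw2, hw3⟩
    refine ⟨fun α h h' => add_nonneg (hv1 α h h') (hw1 α h h'), fun α h h' => ?_, fun x => ?_⟩
    · simp [hv2 α h h', hw2 α h h']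
    · simpa using add_nonneg (hv3 x) (hw3 x)

theorem isClosed_circuitCone {n : ℕ} (A S : Finset (Fin n →₀ ℕ)) (β : Fin n →₀ ℕ) :
    IsClosed (circuitCone A S β : Set (A → ℝ)) := by
  have h : (circuitCone A S β : Set (A → ℝ)) =
      {w | ∀ α : A, (α : Fin n →₀ ℕ) ∈ S → (α : Fin n →₀ ℕ) ≠ β → 0 ≤ w α} ∩
      ({w | ∀ α : A, (α : Fin n →₀ ℕ) ∉ S → (α : Fin n →₀ ℕ) ≠ β → w α = 0} ∩
      {w | ∀ x, 0 ≤ evalCoeffs A x w}) := rfl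
  rw [h]
  simp only [Set.ofPred_forall]
  refine IsClosed.inter ?_ (IsClosed.inter ?_ ?_)
  · exact isClosed_iInter fun α => isClosed_iInter fun _ => isClosed_iInter fun _ =>
      isClosed_le continuous_const (continuous_apply α)
  · exact isClosed_iInter fun α => isClosed_iInter fun _ => isClosed_iInter fun _ =>
      isClosed_eq (continuous_apply α) continuous_const
  · exact isClosed_iInter fun x =>
      isClosed_le continuous_const (evalCoeffs A x).continuous_of_finiteDimensional

theorem circuitCone.smul_mem {n : ℕ} {A S : Finset (Fin n →₀ ℕ)} {β : Fin n →₀ ℕ} {w : A → ℝ}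
    (hw : w ∈ circuitCone A S β) {t : ℝ} (ht : 0 ≤ t) : t • w ∈ circuitCone A S β := by
  obtain ⟨hw1, hw2, hw3⟩ := hw
  refine ⟨fun α h h' => mul_nonneg ht (hw1 α h h'), fun α h h' => ?_, fun x => ?_⟩
  · simp [hw2 α h h']
  · simpa using mul_nonneg ht (hw3 x)

theorem circuitCone.ofCoeffs_mem_cone {n : ℕ} {A S : Finset (Fin n →₀ ℕ)} {β : Fin n →₀ ℕ}
    (h : IsCircuitOn A S β) {w : A → ℝ} (hw : w ∈ circuitCone A S β) :
    ofCoeffs A w ∈ SONCCone A := by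
  classical
  obtain ⟨hw1, hw2, hw3⟩ := hw
  have key : ofCoeffs A w = circuitPoly S β (fun α => if α = β then 0 else coeff α (ofCoeffs A w))
      (coeff β (ofCoeffs A w)) := by
    ext m
    simp only [circuitPoly, coeff_add, coeff_sum, coeff_monomial, Finset.sum_ite_eq']
    by_cases hm : m = β
    · simp [hm]
    · rw [if_neg hm, if_neg (Ne.symm hm), add_zero]
      split_ifs with hmS
      · rfl
      · rw [coeff_ofCoeffs]
        split_ifs with hmA
        · exact hw2 ⟨m, hmA⟩ hmS hm
        · rfl
  rw [key]
  refine h.circuitPoly_mem_cone (fun α hα => ?_) fun x => ?_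
  · split_ifs with hαβ
    · exact le_rfl
    · simpa [coeff_ofCoeffs, h.subset hα] using hw1 ⟨α, h.subset hα⟩ hα hαβ
  · rw [← key, ← evalCoeffs_apply]
    exact hw3 x

theorem SONCGen.exists_mem_circuitCone {n : ℕ} {A : Finset (Fin n →₀ ℕ)}
    {p : MvPolynomial (Fin n) ℝ} (hp : p ∈ SONCGen A) :
    ∃ S β, IsCircuitOn A S β ∧ ∃ w ∈ circuitCone A S β, ofCoeffs A w = p := by
  classical
  rcases id hp with ⟨S, β, c, d, hS, hc, rfl, -⟩ | ⟨β, hβ, heven, rfl⟩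
  · have hw : ofCoeffs A (fun α => coeff (α : Fin n →₀ ℕ) (circuitPoly S β c d)) =
        circuitPoly S β c d := ofCoeffs_coeff fun m hm => by
      simp only [circuitPoly, coeff_add, coeff_sum, coeff_monomial, Finset.sum_ite_eq']
      rw [if_neg fun h => hm (hS.subset h), if_neg fun h : β = m => hm (h ▸ hS.beta_mem), add_zero]
    refine ⟨S, β, hS, _, ⟨fun α h h' => ?_, fun α h h' => ?_, fun x => ?_⟩, hw⟩
    · simpa [circuitPoly, coeff_sum, coeff_monomial, h, h'.symm] using (hc α h).le
    · simp [circuitPoly, coeff_sum, coeff_monomial, h, h'.symm]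
    · rw [evalCoeffs_apply, hw]
      exact SONCCone.eval_nonneg (SONCGen.mem_cone hp) x
  · have hw : ofCoeffs A (fun α => coeff (α : Fin n →₀ ℕ) (monomial β (1 : ℝ))) =
        monomial β 1 := ofCoeffs_coeff fun m hm => by
      rw [coeff_monomial, if_neg fun h : β = m => hm (h ▸ hβ)]
    refine ⟨{β}, β, ⟨by simpa using hβ, by simpa using heven, hβ, ?_, by simp⟩, _,
      ⟨fun α h h' => ?_, fun α h h' => ?_, fun x => ?_⟩, hw⟩
    · exact affineIndependent_of_subsingleton ℝ _
    · exact absurd (Finset.mem_singleton.1 h) h'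
    · rw [coeff_monomial, if_neg h'.symm]
    · rw [evalCoeffs_apply, hw]
      exact SONCCone.eval_nonneg (SONCGen.mem_cone hp) x

open Classical in
/-- The circuits on `A`. -/
noncomputable def circuits {n : ℕ} (A : Finset (Fin n →₀ ℕ)) :
    Finset (Finset (Fin n →₀ ℕ) × (Fin n →₀ ℕ)) :=
  (A.powerset ×ˢ A).filter fun C => IsCircuitOn A C.1 C.2

theorem mem_circuits {n : ℕ} {A : Finset (Fin n →₀ ℕ)}
    {C : Finset (Fin n →₀ ℕ) × (Fin n →₀ ℕ)} : C ∈ circuits A ↔ IsCircuitOn A C.1 C.2 := by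
  simp only [circuits, Finset.mem_filter, Finset.mem_product, Finset.mem_powerset]
  exact ⟨fun h => h.2, fun h => ⟨⟨h.subset, h.beta_mem⟩, h⟩⟩

/-- The SONC cone is the sum of finitely many circuit cones. -/
theorem mem_SONCCone_iff {n : ℕ} {A : Finset (Fin n →₀ ℕ)} {p : MvPolynomial (Fin n) ℝ} :
    p ∈ SONCCone A ↔ ∃ q : circuits A → A → ℝ,
      (∀ C, q C ∈ circuitCone A C.1.1 C.1.2) ∧ ofCoeffs A (∑ C, q C) = p := by
  classical
  constructor
  · rintro ⟨k, g, μ, hg, rfl⟩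
    choose S β hS w hw hwg using fun i => SONCGen.exists_mem_circuitCone (hg i).1
    let j : Fin k → circuits A := fun i => ⟨(S i, β i), mem_circuits.2 (hS i)⟩
    refine ⟨fun C => ∑ i with j i = C, μ i • w i, fun C => sum_mem fun i hi => ?_, ?_⟩
    · obtain rfl := (Finset.mem_filter.1 hi).2
      exact circuitCone.smul_mem (hw i) (hg i).2
    · rw [Finset.sum_fiberwise, map_sum]
      exact Finset.sum_congr rfl fun i _ => by rw [map_smul, hwg]
  · rintro ⟨q, hq, rfl⟩
    rw [map_sum]
    exact SONCCone.sum_mem fun C _ =>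
      circuitCone.ofCoeffs_mem_cone (mem_circuits.1 C.2) (hq C)

/-- The slice of the SONC cone cut out by normalizing the sum of the values on `X`. -/
def SONCBase {n : ℕ} (A : Finset (Fin n →₀ ℕ)) (X : Finset (Fin n → ℝ)) : Set (A → ℝ) :=
  {w | ofCoeffs A w ∈ SONCCone A ∧ ∑ x ∈ X, evalCoeffs A x w = 1}

theorem convex_SONCBase {n : ℕ} (A : Finset (Fin n →₀ ℕ)) (X : Finset (Fin n → ℝ)) :
    Convex ℝ (SONCBase A X) := by
  rintro v ⟨hv, hv1⟩ w ⟨hw, hw1⟩ a b ha hb hab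
  refine ⟨?_, ?_⟩
  · rw [map_add, map_smul, map_smul]
    exact SONCCone.add_mem (SONCCone.smul_mem hv ha) (SONCCone.smul_mem hw hb)
  · simp [Finset.sum_add_distrib, ← Finset.mul_sum, hv1, hw1, hab]

theorem isCompact_SONCBase {n : ℕ} {A : Finset (Fin n →₀ ℕ)} {X : Finset (Fin n → ℝ)}
    (hX : ∀ w, (∀ x ∈ X, eval x (ofCoeffs A w) = 0) → w = 0) : IsCompact (SONCBase A X) := by
  let E : (A → ℝ) →ₗ[ℝ] (X → ℝ) := LinearMap.pi fun x => evalCoeffs A x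
  have hE : LinearMap.ker E = ⊥ := LinearMap.ker_eq_bot'.2 fun w hw => hX w fun x hx => by
    rw [← evalCoeffs_apply]
    exact congrFun hw ⟨x, hx⟩
  have hbox : IsCompact (E ⁻¹' Set.Icc 0 1) :=
    (LinearMap.isClosedEmbedding_of_injective hE).isCompact_preimage isCompact_Icc
  have hpi : IsCompact (Set.univ.pi fun C : circuits A =>
      E ⁻¹' Set.Icc 0 1 ∩ (circuitCone A C.1.1 C.1.2 : Set (A → ℝ))) :=
    isCompact_univ_pi fun C => hbox.inter_right (isClosed_circuitCone A _ _)
  have hcont : Continuous fun q : circuits A → A → ℝ => ∑ C, q C :=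
    continuous_finsetSum _ fun C _ => continuous_apply C
  have hL : Continuous fun w : A → ℝ => ∑ x ∈ X, evalCoeffs A x w :=
    continuous_finsetSum _ fun x _ => (evalCoeffs A x).continuous_of_finiteDimensional
  have himage := (hpi.inter_right
    (isClosed_eq (hL.comp hcont) (continuous_const (y := (1 : ℝ))))).image hcont
  convert himage using 1
  ext w
  constructor
  · rintro ⟨hw, hw1⟩
    obtain ⟨q, hq, hqw⟩ := mem_SONCCone_iff.1 hw
    obtain rfl := ofCoeffs_injective A hqw
    refine ⟨q, ⟨fun C _ => ⟨⟨fun x => (hq C).2.2 x, fun x => ?_⟩, hq C⟩, hw1⟩, rfl⟩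
    calc evalCoeffs A x (q C) ≤ ∑ C, evalCoeffs A x (q C) :=
          Finset.single_le_sum (fun C _ => (hq C).2.2 x) (Finset.mem_univ C)
      _ = evalCoeffs A x (∑ C, q C) := (map_sum _ _ _).symm
      _ ≤ ∑ x ∈ X, evalCoeffs A x (∑ C, q C) :=
          Finset.single_le_sum (f := fun x => evalCoeffs A x (∑ C, q C)) (fun x _ => by
            rw [map_sum]
            exact Finset.sum_nonneg fun C _ => (hq C).2.2 x) x.2
      _ = 1 := hw1
  · rintro ⟨q, ⟨hq, hq1⟩, rfl⟩
    exact ⟨mem_SONCCone_iff.2 ⟨q, fun C => (hq C trivial).2, rfl⟩, hq1⟩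

/-- Every nonzero element of the SONC cone is a positive multiple of an element of the slice. -/
theorem exists_mem_SONCBase {n : ℕ} {A : Finset (Fin n →₀ ℕ)} {X : Finset (Fin n → ℝ)}
    (hX : ∀ w, (∀ x ∈ X, eval x (ofCoeffs A w) = 0) → w = 0) {p : MvPolynomial (Fin n) ℝ}
    (hp : p ∈ SONCCone A) (hp0 : p ≠ 0) :
    ∃ t : ℝ, 0 < t ∧ ∃ w ∈ SONCBase A X, p = t • ofCoeffs A w := by
  obtain ⟨q, -, rfl⟩ := mem_SONCCone_iff.1 hp
  set w := ∑ C, q C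
  have hnonneg : ∀ x ∈ X, 0 ≤ evalCoeffs A x w := fun x _ => by
    rw [evalCoeffs_apply]
    exact SONCCone.eval_nonneg hp x
  have hpos : 0 < ∑ x ∈ X, evalCoeffs A x w := by
    refine (Finset.sum_nonneg hnonneg).lt_of_ne fun h => hp0 ?_
    rw [hX w fun x hx => ?_, map_zero]
    rw [← evalCoeffs_apply]
    exact (Finset.sum_eq_zero_iff_of_nonneg hnonneg).1 h.symm x hx
  refine ⟨_, hpos, (∑ x ∈ X, evalCoeffs A x w)⁻¹ • w, ⟨?_, ?_⟩, ?_⟩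
  · rw [map_smul]
    exact SONCCone.smul_mem hp (inv_nonneg.2 hpos.le)
  · simp_rw [map_smul, smul_eq_mul, ← Finset.mul_sum]
    exact inv_mul_cancel₀ hpos.ne'
  · rw [map_smul, smul_inv_smul₀ hpos.ne']

theorem mass_eq_of_smul_eq_smul {n : ℕ} {A : Finset (Fin n →₀ ℕ)} {X : Finset (Fin n → ℝ)}
    {v w : A → ℝ} (hv : v ∈ SONCBase A X) (hw : w ∈ SONCBase A X) {s t : ℝ}
    (h : s • ofCoeffs A v = t • ofCoeffs A w) : s = t := by
  rw [← map_smul, ← map_smul] at h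
  have := congrArg (fun u => ∑ x ∈ X, evalCoeffs A x u) (ofCoeffs_injective A h)
  simpa [← Finset.mul_sum, hv.2, hw.2] using this

theorem ne_zero_of_mem_SONCBase {n : ℕ} {A : Finset (Fin n →₀ ℕ)} {X : Finset (Fin n → ℝ)}
    {w : A → ℝ} (hw : w ∈ SONCBase A X) : ofCoeffs A w ≠ 0 := fun h => by
  have := hw.2
  simp [evalCoeffs_apply, h] at this

theorem zero_mem_raySet {n : ℕ} (p : MvPolynomial (Fin n) ℝ) : 0 ∈ raySet p :=
  ⟨0, le_rfl, (zero_smul ℝ p).symm⟩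

theorem self_mem_raySet {n : ℕ} (p : MvPolynomial (Fin n) ℝ) : p ∈ raySet p :=
  ⟨1, zero_le_one, (one_smul ℝ p).symm⟩

/-- Extreme points of the slice generate extreme rays of the cone. -/
theorem isExtremeRay_of_mem_extremePoints {n : ℕ} {A : Finset (Fin n →₀ ℕ)}
    {X : Finset (Fin n → ℝ)} (hX : ∀ w, (∀ x ∈ X, eval x (ofCoeffs A w) = 0) → w = 0)
    {e : A → ℝ} (he : e ∈ (SONCBase A X).extremePoints ℝ) :
    IsExtremeRay (SONCCone A) (ofCoeffs A e) := by
  have heB := extremePoints_subset he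
  refine ⟨ne_zero_of_mem_SONCBase heB, heB.1, fun g h hg hh hsum => ?_⟩
  rcases eq_or_ne g 0 with rfl | hg0
  · rw [zero_add] at hsum
    exact ⟨zero_mem_raySet _, hsum ▸ self_mem_raySet _⟩
  rcases eq_or_ne h 0 with rfl | hh0
  · rw [add_zero] at hsum
    exact ⟨hsum ▸ self_mem_raySet _, zero_mem_raySet _⟩
  obtain ⟨s, hs, v, hv, rfl⟩ := exists_mem_SONCBase hX hg hg0
  obtain ⟨t, ht, w, hw, rfl⟩ := exists_mem_SONCBase hX hh hh0
  rw [← map_smul, ← map_smul, ← map_add] at hsum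
  have hsum := ofCoeffs_injective A hsum
  have hst : s + t = 1 := by
    have := heB.2
    simpa [hsum, Finset.sum_add_distrib, ← Finset.mul_sum, hv.2, hw.2] using this
  obtain ⟨hve, hwe⟩ := (mem_extremePoints.1 he).2 v hv w hw ⟨s, t, hs, ht, hst, hsum.symm⟩
  exact ⟨⟨s, hs.le, by rw [hve]⟩, ⟨t, ht.le, by rw [hwe]⟩⟩

/-- A linear functional on a compact convex set that is positive at every extreme point but one,
where it vanishes, is positive away from that point. -/
theorem eq_or_pos_of_extremePoints {E : Type*} [NormedAddCommGroup E] [NormedSpace ℝ E]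
    {B : Set E} (hB : IsCompact B) (hconv : Convex ℝ B) (l : E →L[ℝ] ℝ) {e₀ : E} (h₀ : l e₀ = 0)
    (h : ∀ e ∈ B.extremePoints ℝ, e = e₀ ∨ 0 < l e) {b : E} (hb : b ∈ B) : b = e₀ ∨ 0 < l b := by
  obtain ⟨z, hzB, hz⟩ := hB.exists_isMinOn ⟨b, hb⟩ l.continuous.continuousOn
  have hface : IsExposed ℝ B {y ∈ B | ∀ z ∈ B, (-l) z ≤ (-l) y} := fun _ => ⟨-l, rfl⟩
  set F := {y ∈ B | ∀ z ∈ B, (-l) z ≤ (-l) y}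
  have hzF : z ∈ F := ⟨hzB, fun y hy => by simpa using hz hy⟩
  have hval : ∀ y ∈ F, l y = l z := fun y hy =>
    le_antisymm (by simpa using hy.2 z hzB) (hz hy.1)
  have hcompact := hface.isCompact hB
  have hext : ∀ e ∈ F.extremePoints ℝ, e = e₀ ∨ 0 < l e := fun e he =>
    h e (hface.isExtreme.extremePoints_subset_extremePoints he)
  have hzb : l z ≤ l b := hz hb
  obtain ⟨e, he⟩ := hcompact.extremePoints_nonempty ⟨z, hzF⟩
  have hez := hval e (extremePoints_subset he)
  rcases (show 0 ≤ l z by rcases hext e he with rfl | hpos <;> linarith).lt_or_eq with hz0 | hz0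
  · exact Or.inr (hz0.trans_le hzb)
  rcases hzb.lt_or_eq with hlt | heq
  · exact Or.inr (hz0 ▸ hlt)
  left
  have hbF : b ∈ F := ⟨hb, fun y hy => by simpa [← heq] using hz hy⟩
  rw [← closure_convexHull_extremePoints hcompact (hface.convex hconv)] at hbF
  refine closure_minimal (convexHull_min (t := {e₀}) (fun e he => ?_) (convex_singleton e₀))
    isClosed_singleton hbF
  refine (hext e he).resolve_right fun hpos => ?_
  rw [hval e (extremePoints_subset he), ← hz0] at hpos
  exact lt_irrefl _ hpos

/-- **Exposure criterion via extreme rays.** If a linear functional vanishes on the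
generator `f` of an extreme ray of the SONC cone and is strictly positive on the
generators of all other extreme rays, then the ray `ℝ₊ · f` is exposed. -/
theorem exposed_of_positive_on_other_extreme_rays {n : ℕ} (A : Finset (Fin n →₀ ℕ))
    (hA : A.Nonempty) (f : MvPolynomial (Fin n) ℝ)
    (hf : IsExtremeRay (SONCCone A) f) (l : MvPolynomial (Fin n) ℝ →ₗ[ℝ] ℝ)
    (hl0 : l f = 0)
    (hlpos : ∀ g, IsExtremeRay (SONCCone A) g → raySet g ≠ raySet f → 0 < l g) :
    IsExposedRay (SONCCone A) f := by
  obtain ⟨X, hX⟩ := exists_finset_eval_injective A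
  obtain ⟨s, hs, w₀, hw₀, hfw⟩ := exists_mem_SONCBase hX hf.2.1 hf.1
  let L : (A → ℝ) →L[ℝ] ℝ := (l ∘ₗ ofCoeffs A).toContinuousLinearMap
  have hL0 : L w₀ = 0 := by
    rw [hfw, map_smul, smul_eq_mul] at hl0
    exact (mul_eq_zero.1 hl0).resolve_left hs.ne'
  have hext : ∀ e ∈ (SONCBase A X).extremePoints ℝ, e = w₀ ∨ 0 < L e := by
    intro e he
    by_cases hray : raySet (ofCoeffs A e) = raySet f
    · left
      obtain ⟨t, -, ht⟩ : ofCoeffs A e ∈ raySet f := hray ▸ self_mem_raySet _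
      rw [hfw, smul_smul, ← one_smul ℝ (ofCoeffs A e)] at ht
      have hts := mass_eq_of_smul_eq_smul (extremePoints_subset he) hw₀ ht
      rw [← hts, one_smul, one_smul] at ht
      exact ofCoeffs_injective A ht
    · exact Or.inr (hlpos _ (isExtremeRay_of_mem_extremePoints hX he) hray)
  refine ⟨l, ?_, fun g hg => ?_⟩
  · rintro _ ⟨t, -, rfl⟩
    rw [map_smul, hl0, smul_zero]
  have hg0 : g ≠ 0 := fun h => hg.2 (h ▸ zero_mem_raySet f)
  obtain ⟨t, ht, w, hw, rfl⟩ := exists_mem_SONCBase hX hg.1 hg0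
  rcases eq_or_pos_of_extremePoints (isCompact_SONCBase hX) (convex_SONCBase A X) L hL0 hext hw
    with rfl | hpos
  · refine absurd ⟨t * s⁻¹, by positivity, ?_⟩ hg.2
    rw [hfw, smul_smul, inv_mul_cancel_right₀ hs.ne']
  · rw [map_smul]
    exact mul_pos ht hpos
end

section
/- Let A ⊆ ℕ^n be a finite set, let (S, β) be a reduced circuit on A, and let E be a finite set with S ∪ {β} ⊆ E ⊆ (A ∩ (2ℕ)^n) ∪ {β}. If E ≠ S ∪ {β}, then the convex hull conv(E) has a vertex (extreme point) belonging to E \ (S ∪ {β}). -/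
open MvPolynomial Finset

/-- **Vertex outside `S ∪ {β}`.** For a reduced circuit `(S, β)` on `A` and a finite
set `E` with `S ∪ {β} ⊆ E ⊆ (A ∩ (2ℕ)ⁿ) ∪ {β}` and `E ≠ S ∪ {β}`, the convex hull
of `E` has a vertex (extreme point) belonging to `E \ (S ∪ {β})`. -/
theorem exists_vertex_outside {n : ℕ} (A : Finset (Fin n →₀ ℕ))
    (S : Finset (Fin n →₀ ℕ)) (β : Fin n →₀ ℕ) (hred : IsReducedCircuitOn A S β)
    (E : Finset (Fin n →₀ ℕ)) (hSE : S ∪ {β} ⊆ E)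
    (hEA : ∀ γ ∈ E, (γ ∈ A ∧ IsEvenPt γ) ∨ γ = β) (hne : E ≠ S ∪ {β}) :
    ∃ v ∈ E, v ∉ S ∪ {β} ∧
      toR v ∈ Set.extremePoints ℝ (convexHull ℝ (toR '' (E : Set (Fin n →₀ ℕ)))) := by
  by_contra! hcon
  obtain ⟨hcirc, heq⟩ := hred
  set K := convexHull ℝ (toR '' (E : Set (Fin n →₀ ℕ)))
  have hfin : (toR '' (E : Set (Fin n →₀ ℕ))).Finite := E.finite_toSet.image _
  have hext : K.extremePoints ℝ ⊆ convexHull ℝ (toR '' (S : Set (Fin n →₀ ℕ))) := by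
    intro x hx
    obtain ⟨v, hvE, rfl⟩ := extremePoints_convexHull_subset hx
    by_cases hv : v ∈ S ∪ {β}
    · rcases Finset.mem_union.1 hv with h | h
      · exact subset_convexHull ℝ _ ⟨v, h, rfl⟩
      · rw [Finset.mem_singleton.1 h]
        exact intrinsicInterior_subset hcirc.relint
    · exact absurd hx (hcon v hvE hv)
  have hKS : K ⊆ convexHull ℝ (toR '' (S : Set (Fin n →₀ ℕ))) := by
    have hKcompact : IsCompact K := hfin.isCompact_convexHull ℝ
    rw [← closure_convexHull_extremePoints hKcompact (convex_convexHull ℝ _)]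
    exact closure_minimal (convexHull_min hext (convex_convexHull ℝ _))
      ((S.finite_toSet.image _).isClosed_convexHull ℝ)
  refine hne (Finset.Subset.antisymm (fun γ hγ => ?_) hSE)
  rw [Finset.mem_union, Finset.mem_singleton]
  rcases hEA γ hγ with ⟨hA, heven⟩ | h
  · exact (heq.subset ⟨hA, heven, hKS (subset_convexHull ℝ _ ⟨γ, hγ, rfl⟩)⟩).1
  · exact Or.inr h
end

section
/- Let A ⊆ ℕ^n be a finite set. Every polynomial f in the SONC cone C(A) can be written as a finite nonnegative combination of nonnegative circuit polynomials supported on reduced circuits on A and monomial squares x^α with α ∈ A ∩ (2ℕ)^n. -/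
open MvPolynomial Finset

/-- Generators of the SONC cone coming only from reduced circuits. -/
def SONCGenReduced {n : ℕ} (A : Finset (Fin n →₀ ℕ)) : Set (MvPolynomial (Fin n) ℝ) :=
  {f | (∃ S β c d, IsReducedCircuitOn A S β ∧ (∀ α ∈ S, 0 < c α) ∧
          f = circuitPoly S β c d ∧ ∀ x : Fin n → ℝ, 0 ≤ eval x f) ∨
       (∃ α ∈ A, IsEvenPt α ∧ f = monomial α 1)}

/-- Affine independence of a finite set of exponents, in coordinates. -/
lemma affineIndependent_toR_iff {n : ℕ} {S : Finset (Fin n →₀ ℕ)} :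
    AffineIndependent ℝ (fun α : S => toR (α : Fin n →₀ ℕ)) ↔
      ∀ w : (Fin n →₀ ℕ) → ℝ, ∑ α ∈ S, w α = 0 →
        (∀ i, ∑ α ∈ S, w α * (α i : ℝ) = 0) → ∀ α ∈ S, w α = 0 := by
  classical
  rw [affineIndependent_iff_of_fintype]
  have key : ∀ w : (Fin n →₀ ℕ) → ℝ, ∑ α ∈ S, w α = 0 →
      ((Finset.univ : Finset S).weightedVSub (fun α : S => toR (α : Fin n →₀ ℕ))
        (fun α : S => w α) = 0 ↔ ∀ i, ∑ α ∈ S, w α * (α i : ℝ) = 0) := by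
    intro w hw
    rw [Finset.weightedVSub_eq_linear_combination _
      (by rw [Finset.sum_coe_sort S w, hw]), funext_iff]
    refine forall_congr' fun i => ?_
    rw [Finset.sum_apply, ← Finset.sum_coe_sort S]
    simp [toR]
  constructor
  · intro h w h0 h1 α hα
    exact h (fun α : S => w α) (by rw [Finset.sum_coe_sort S w, h0]) ((key w h0).2 h1) ⟨α, hα⟩
  · intro h w h0 h1 α
    let w' : (Fin n →₀ ℕ) → ℝ := fun α => if hα : α ∈ S then w ⟨α, hα⟩ else 0
    have hw' : (fun α : S => w' α) = w := by
      funext α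
      simp [w']
    have h0' : ∑ α ∈ S, w' α = 0 := by
      rw [← Finset.sum_coe_sort S w', hw', h0]
    have := h w' h0' ((key w' h0').1 (by rw [hw', h1])) α α.2
    rwa [← hw']

/-- A point of the convex hull of a finite set of exponents, in barycentric coordinates. -/
lemma mem_convexHull_toR_iff {n : ℕ} {S : Finset (Fin n →₀ ℕ)} {x : Fin n → ℝ} :
    x ∈ convexHull ℝ (toR '' (S : Set (Fin n →₀ ℕ))) ↔
      ∃ w : (Fin n →₀ ℕ) → ℝ, (∀ α ∈ S, 0 ≤ w α) ∧ ∑ α ∈ S, w α = 1 ∧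
        ∀ i, x i = ∑ α ∈ S, w α * (α i : ℝ) := by
  classical
  constructor
  · intro hx
    have hinj : Set.InjOn (toR (n := n)) (S : Set (Fin n →₀ ℕ)) := by
      intro a _ b _ h
      ext i
      exact Nat.cast_injective (R := ℝ) (congrFun h i)
    rw [← Finset.coe_image, Finset.mem_convexHull'] at hx
    obtain ⟨w, h0, h1, h2⟩ := hx
    rw [Finset.sum_image hinj] at h1 h2
    refine ⟨fun α => w (toR α), fun α hα => h0 _ (Finset.mem_image_of_mem _ hα), h1, fun i => ?_⟩
    rw [← h2]
    simp [toR]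
  · rintro ⟨w, h0, h1, h2⟩
    have : x = ∑ α ∈ S, w α • toR α := by
      funext i
      simp [h2, toR]
    rw [this]
    exact (convex_convexHull ℝ _).sum_mem h0 h1
      fun α hα => subset_convexHull ℝ _ ⟨α, hα, rfl⟩

/-- Barycentric coordinates on an affinely independent set of exponents are unique. -/
lemma barycentric_unique {n : ℕ} {S : Finset (Fin n →₀ ℕ)}
    (hS : AffineIndependent ℝ (fun α : S => toR (α : Fin n →₀ ℕ)))
    {u v : (Fin n →₀ ℕ) → ℝ} (h0 : ∑ α ∈ S, u α = ∑ α ∈ S, v α)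
    (h1 : ∀ i, ∑ α ∈ S, u α * (α i : ℝ) = ∑ α ∈ S, v α * (α i : ℝ)) :
    ∀ α ∈ S, u α = v α := by
  intro α hα
  refine sub_eq_zero.1 (affineIndependent_toR_iff.1 hS (fun α => u α - v α) ?_ (fun i => ?_) α hα)
  · rw [Finset.sum_sub_distrib, h0, sub_self]
  · simp only [sub_mul]
    rw [Finset.sum_sub_distrib, h1, sub_self]

/-- An affine function takes arbitrary prescribed values on an affinely independent set. -/
lemma exists_affine_interpolation {n : ℕ} {S : Finset (Fin n →₀ ℕ)}
    (hS : AffineIndependent ℝ (fun α : S => toR (α : Fin n →₀ ℕ))) (v : (Fin n →₀ ℕ) → ℝ) :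
    ∃ (a : ℝ) (y : Fin n → ℝ), ∀ α ∈ S, a + ∑ i, y i * (α i : ℝ) = v α := by
  classical
  let T : (S → ℝ) →ₗ[ℝ] ℝ × (Fin n → ℝ) :=
    Fintype.linearCombination ℝ (fun α : S => ((1 : ℝ), toR (α : Fin n →₀ ℕ)))
  have hT : LinearMap.ker T = ⊥ := by
    rw [LinearMap.ker_eq_bot']
    intro w hw
    rw [affineIndependent_iff_of_fintype] at hS
    simp only [T, Fintype.linearCombination_apply, Prod.ext_iff, Prod.fst_sum, Prod.snd_sum,
      Prod.smul_fst, Prod.smul_snd, smul_eq_mul, mul_one, Prod.fst_zero, Prod.snd_zero] at hw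
    funext α
    refine hS w hw.1 ?_ α
    rw [Finset.weightedVSub_eq_linear_combination _ hw.1, hw.2]
  obtain ⟨g, hg⟩ := T.exists_leftInverse_of_injective hT
  let φ : ℝ × (Fin n → ℝ) →ₗ[ℝ] ℝ :=
    (Fintype.linearCombination ℝ (fun α : S => v (α : Fin n →₀ ℕ))) ∘ₗ g
  refine ⟨φ (1, 0), fun i => φ (0, Pi.single i 1), fun α hα => ?_⟩
  have h1 : φ (1, toR α) = v α := by
    have : T (Pi.single ⟨α, hα⟩ 1) = (1, toR α) := by
      simp [T, Fintype.linearCombination_apply_single]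
    rw [← this]
    change Fintype.linearCombination ℝ _ ((g ∘ₗ T) (Pi.single ⟨α, hα⟩ 1)) = _
    rw [hg]
    simp [Fintype.linearCombination_apply_single]
  have h2 : ((1 : ℝ), toR α) =
      (1, 0) + ∑ i, (α i : ℝ) • ((0 : ℝ), (Pi.single i 1 : Fin n → ℝ)) := by
    ext j
    · simp [Prod.fst_sum]
    · simp [Prod.snd_sum, toR, Finset.sum_apply, Pi.single_apply]
  rw [← h1, h2, map_add, map_sum]
  simp only [map_smul, smul_eq_mul, mul_comm]

/-- The relative interior of a simplex consists of the points with positive barycentric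
coordinates. -/
lemma mem_intrinsicInterior_iff {n : ℕ} {S : Finset (Fin n →₀ ℕ)}
    (hS : AffineIndependent ℝ (fun α : S => toR (α : Fin n →₀ ℕ))) (β : Fin n →₀ ℕ) :
    toR β ∈ intrinsicInterior ℝ (convexHull ℝ (toR '' (S : Set (Fin n →₀ ℕ)))) ↔
      ∃ w, IsBarycentric S β w := by
  classical
  set C := convexHull ℝ (toR '' (S : Set (Fin n →₀ ℕ))) with hC
  rw [mem_intrinsicInterior]
  constructor
  · rintro ⟨x, hx, hxβ⟩
    have hβC : toR β ∈ C := by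
      rw [← hxβ]
      exact Set.mem_preimage.1 (interior_subset hx)
    obtain ⟨w, hw0, hw1, hw2⟩ := mem_convexHull_toR_iff.1 hβC
    refine ⟨w, fun α hα => lt_of_le_of_ne (hw0 α hα) fun hα0 => ?_, hw1, hw2⟩
    have hαC : toR α ∈ affineSpan ℝ C :=
      subset_affineSpan ℝ _ (subset_convexHull ℝ _ ⟨α, hα, rfl⟩)
    let g : ℝ → affineSpan ℝ C := fun t => ⟨AffineMap.lineMap (toR β) (toR α) t,
      AffineMap.lineMap_mem t (subset_affineSpan ℝ _ hβC) hαC⟩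
    have hg : Continuous g := AffineMap.lineMap_continuous.subtype_mk _
    have hg0 : g 0 = x := Subtype.ext (by simp [g, hxβ])
    have hev : ∀ᶠ t in nhds (0 : ℝ), (g t : Fin n → ℝ) ∈ C := by
      have : interior ((↑) ⁻¹' C : Set (affineSpan ℝ C)) ∈ nhds (g 0) := by
        rw [hg0]
        exact isOpen_interior.mem_nhds hx
      filter_upwards [hg.continuousAt this] with t ht
      have htC := interior_subset (Set.mem_preimage.1 ht)
      exact htC
    obtain ⟨t, htC, ht⟩ := ((hev.filter_mono nhdsWithin_le_nhds).and
      (self_mem_nhdsWithin : Set.Iio (0 : ℝ) ∈ nhdsWithin 0 (Set.Iio 0))).exists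
    obtain ⟨u, hu0, hu1, hu2⟩ := mem_convexHull_toR_iff.1 htC
    have hgt : ∀ i, (g t : Fin n → ℝ) i = (1 - t) * (β i : ℝ) + t * (α i : ℝ) := by
      intro i
      simp [g, AffineMap.lineMap_apply_module, toR]
    have := barycentric_unique hS (u := u)
      (v := fun γ => (1 - t) * w γ + t * if γ = α then 1 else 0) ?_ ?_ α hα
    · have h := hu0 α hα
      simp [← hα0] at this
      have : t < 0 := ht
      linarith
    · rw [hu1, Finset.sum_add_distrib, ← Finset.mul_sum, ← Finset.mul_sum, hw1]
      simp [hα]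
    · intro i
      rw [← hu2, hgt, show (β i : ℝ) = _ from hw2 i, Finset.mul_sum]
      simp only [add_mul, Finset.sum_add_distrib]
      congr 1
      · exact Finset.sum_congr rfl fun _ _ => by ring
      · simp [hα]
  · rintro ⟨w, hw0, hw1, hw2⟩
    have hβC : toR β ∈ C := mem_convexHull_toR_iff.2 ⟨w, fun α hα => (hw0 α hα).le, hw1, hw2⟩
    refine ⟨⟨toR β, subset_affineSpan ℝ _ hβC⟩, ?_, rfl⟩
    choose a y hay using fun α => exists_affine_interpolation hS (fun γ => if γ = α then 1 else 0)
    let L : (Fin n →₀ ℕ) → (Fin n → ℝ) → ℝ := fun α x => a α + ∑ i, y α i * x i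
    have hLc : ∀ α, Continuous (L α) := fun α => by fun_prop
    have hL : ∀ (u : (Fin n →₀ ℕ) → ℝ) (x : Fin n → ℝ), ∑ α ∈ S, u α = 1 →
        (∀ i, x i = ∑ α ∈ S, u α * (α i : ℝ)) → ∀ α ∈ S, L α x = u α := by
      intro u x hu hx α hα
      calc L α x = ∑ γ ∈ S, u γ * (a α + ∑ i, y α i * (γ i : ℝ)) := by
            simp only [L, hx, mul_add, Finset.sum_add_distrib, ← Finset.sum_mul, hu, one_mul,
              Finset.mul_sum]
            rw [Finset.sum_comm]
            congr 1
            exact Finset.sum_congr rfl fun _ _ => Finset.sum_congr rfl fun _ _ => by ring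
        _ = ∑ γ ∈ S, u γ * (if γ = α then 1 else 0) :=
            Finset.sum_congr rfl fun γ hγ => by rw [hay α γ hγ]
        _ = u α := by simp [hα]
    refine mem_interior.2 ⟨⋂ α ∈ S, {x : affineSpan ℝ C | 0 < L α x}, ?_, ?_, ?_⟩
    · intro x hx
      simp only [Set.mem_iInter] at hx
      have hxs : (x : Fin n → ℝ) ∈
          affineSpan ℝ (Set.range fun α : S => toR (α : Fin n →₀ ℕ)) := by
        have h : affineSpan ℝ C =
            affineSpan ℝ (Set.range fun α : S => toR (α : Fin n →₀ ℕ)) := by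
          rw [hC, affineSpan_convexHull, Set.image_eq_range]
          rfl
        exact h ▸ x.2
      obtain ⟨u', hu', hxu'⟩ := eq_affineCombination_of_mem_affineSpan_of_fintype hxs
      let u : (Fin n →₀ ℕ) → ℝ := fun α => if hα : α ∈ S then u' ⟨α, hα⟩ else 0
      have huu : (fun α : S => u α) = u' := by
        funext α
        simp [u]
      have hu1 : ∑ α ∈ S, u α = 1 := by
        rw [← Finset.sum_coe_sort S u, huu, hu']
      have hu2 : ∀ i, (x : Fin n → ℝ) i = ∑ α ∈ S, u α * (α i : ℝ) := by
        intro i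
        rw [hxu', Finset.affineCombination_eq_linear_combination _ _ _ hu', ← huu,
          Finset.sum_apply, ← Finset.sum_coe_sort S]
        simp [toR]
      refine mem_convexHull_toR_iff.2 ⟨u, fun α hα => ?_, hu1, hu2⟩
      rw [← hL u x hu1 hu2 α hα]
      exact (hx α hα).le
    · exact isOpen_biInter_finset fun α _ =>
        isOpen_lt continuous_const ((hLc α).comp continuous_subtype_val)
    · simp only [Set.mem_iInter]
      intro α hα
      change 0 < L α (toR β)
      rw [hL w (toR β) hw1 hw2 α hα]
      exact hw0 α hα

/-- The exponential of the affine function `p ↦ a + ⟨y, p⟩`. -/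
noncomputable def expAffine {n : ℕ} (a : ℝ) (y : Fin n → ℝ) (α : Fin n →₀ ℕ) : ℝ :=
  Real.exp (a + ∑ i, y i * (α i : ℝ))

lemma expAffine_pos {n : ℕ} (a : ℝ) (y : Fin n → ℝ) (α : Fin n →₀ ℕ) : 0 < expAffine a y α :=
  Real.exp_pos _

/-- The circuit polynomial with outer coefficients `w α * E α` and inner coefficient `σ * E β`,
where `E = expAffine a y`. For `σ = -1` this is the equality case of the circuit number bound. -/
noncomputable def agmPoly {n : ℕ} (a : ℝ) (y : Fin n → ℝ) (S : Finset (Fin n →₀ ℕ))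
    (β : Fin n →₀ ℕ) (w : (Fin n →₀ ℕ) → ℝ) (σ : ℝ) : MvPolynomial (Fin n) ℝ :=
  circuitPoly S β (fun α => w α * expAffine a y α) (σ * expAffine a y β)

lemma agmPoly_congr {n : ℕ} {a : ℝ} {y : Fin n → ℝ} {S : Finset (Fin n →₀ ℕ)}
    {β : Fin n →₀ ℕ} {w w' : (Fin n →₀ ℕ) → ℝ} {σ : ℝ} (h : ∀ α ∈ S, w α = w' α) :
    agmPoly a y S β w σ = agmPoly a y S β w' σ := by
  unfold agmPoly circuitPoly
  congr 1
  exact Finset.sum_congr rfl fun α hα => by simp only [h α hα]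

lemma eval_circuitPoly {n : ℕ} (S : Finset (Fin n →₀ ℕ)) (β : Fin n →₀ ℕ)
    (c : (Fin n →₀ ℕ) → ℝ) (d : ℝ) (x : Fin n → ℝ) :
    eval x (circuitPoly S β c d) =
      ∑ α ∈ S, c α * ∏ i, x i ^ α i + d * ∏ i, x i ^ β i := by
  have h : ∀ (α : Fin n →₀ ℕ) (r : ℝ), eval x (monomial α r) = r * ∏ i, x i ^ α i := by
    intro α r
    rw [eval_monomial, Finsupp.prod_fintype _ _ fun i => pow_zero _]
  simp only [circuitPoly, map_add, map_sum, h]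

/-- Weighted AM-GM for monomials. -/
lemma agmPoly_nonneg {n : ℕ} (a : ℝ) (y : Fin n → ℝ) {S : Finset (Fin n →₀ ℕ)}
    {β : Fin n →₀ ℕ} {w : (Fin n →₀ ℕ) → ℝ} (hS : ∀ α ∈ S, IsEvenPt α)
    (hw : IsBarycentric S β w) {σ : ℝ} (hσ : |σ| ≤ 1) (x : Fin n → ℝ) :
    0 ≤ eval x (agmPoly a y S β w σ) := by
  obtain ⟨hw0, hw1, hw2⟩ := hw
  let z : (Fin n →₀ ℕ) → ℝ := fun α => expAffine a y α * ∏ i, |x i| ^ α i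
  have hz : ∀ α, 0 ≤ z α := fun α =>
    mul_nonneg (expAffine_pos a y α).le (Finset.prod_nonneg fun i _ => pow_nonneg (abs_nonneg _) _)
  have hexp : ∏ α ∈ S, expAffine a y α ^ w α = expAffine a y β := by
    simp only [expAffine, ← Real.exp_mul]
    rw [← Real.exp_sum]
    congr 1
    simp only [add_mul, Finset.sum_add_distrib, ← Finset.mul_sum, hw1, mul_one, hw2,
      Finset.sum_mul]
    rw [Finset.sum_comm]
    congr 1
    refine Finset.sum_congr rfl fun i _ => ?_
    rw [Finset.mul_sum]
    exact Finset.sum_congr rfl fun _ _ => by ring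
  have hprod : ∏ α ∈ S, (∏ i, |x i| ^ α i) ^ w α = ∏ i, |x i| ^ β i := by
    calc ∏ α ∈ S, (∏ i, |x i| ^ α i) ^ w α
        = ∏ α ∈ S, ∏ i, |x i| ^ (w α * (α i : ℝ)) := by
          refine Finset.prod_congr rfl fun α _ => ?_
          rw [← Real.finsetProd_rpow _ _ fun i _ => pow_nonneg (abs_nonneg _) _]
          refine Finset.prod_congr rfl fun i _ => ?_
          rw [← Real.rpow_natCast, ← Real.rpow_mul (abs_nonneg _), mul_comm]
      _ = ∏ i, |x i| ^ β i := by
          rw [Finset.prod_comm]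
          refine Finset.prod_congr rfl fun i _ => ?_
          rw [← Real.rpow_sum_of_nonneg (abs_nonneg _)
            fun α hα => mul_nonneg (hw0 α hα).le (Nat.cast_nonneg _), ← hw2, Real.rpow_natCast]
  have hamgm : z β ≤ ∑ α ∈ S, w α * z α := by
    have h := Real.geom_mean_le_arith_mean_weighted S w z (fun α hα => (hw0 α hα).le) hw1
      fun α _ => hz α
    have hzβ : ∏ α ∈ S, z α ^ w α = z β := by
      simp only [z]
      rw [← hexp, ← hprod, ← Finset.prod_mul_distrib]
      exact Finset.prod_congr rfl fun α _ => Real.mul_rpow (expAffine_pos a y α).le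
        (Finset.prod_nonneg fun i _ => pow_nonneg (abs_nonneg _) _)
    rwa [hzβ] at h
  rw [agmPoly, eval_circuitPoly]
  have hsum : ∑ α ∈ S, w α * expAffine a y α * ∏ i, x i ^ α i = ∑ α ∈ S, w α * z α := by
    refine Finset.sum_congr rfl fun α hα => ?_
    simp only [z, (hS α hα _).pow_abs]
    ring
  have hβ : |σ * expAffine a y β * ∏ i, x i ^ β i| ≤ z β := by
    rw [mul_assoc, abs_mul, abs_mul, abs_of_pos (expAffine_pos a y β), Finset.abs_prod]
    simp only [abs_pow]
    exact mul_le_of_le_one_left (hz β) hσ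
  rw [hsum]
  linarith [neg_abs_le (σ * expAffine a y β * ∏ i, x i ^ β i)]

/-- A nonnegative circuit polynomial satisfies the circuit number bound, expressed by the affine
function interpolating `log (c α / w α)` on the vertices of the circuit. -/
lemma exists_expAffine_of_nonneg {n : ℕ} {S : Finset (Fin n →₀ ℕ)} {β : Fin n →₀ ℕ}
    {c w : (Fin n →₀ ℕ) → ℝ} {d : ℝ} (hS : ∀ α ∈ S, IsEvenPt α)
    (hind : AffineIndependent ℝ (fun α : S => toR (α : Fin n →₀ ℕ)))
    (hw : IsBarycentric S β w) (hc : ∀ α ∈ S, 0 < c α)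
    (hf : ∀ x : Fin n → ℝ, 0 ≤ eval x (circuitPoly S β c d)) :
    ∃ (a : ℝ) (y : Fin n → ℝ), (∀ α ∈ S, c α = w α * expAffine a y α) ∧
      -expAffine a y β ≤ d ∧ (¬ IsEvenPt β → d ≤ expAffine a y β) := by
  classical
  obtain ⟨hw0, hw1, hw2⟩ := hw
  obtain ⟨a, y, hay⟩ := exists_affine_interpolation hind (fun α => Real.log (c α / w α))
  have hcw : ∀ α ∈ S, c α = w α * expAffine a y α := by
    intro α hα
    rw [expAffine, hay α hα, Real.exp_log (div_pos (hc α hα) (hw0 α hα)),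
      mul_div_cancel₀ _ (hw0 α hα).ne']
  have hmon : ∀ α : Fin n →₀ ℕ,
      expAffine a y α * ∏ i, Real.exp (-y i) ^ α i = Real.exp a := by
    intro α
    simp only [← Real.exp_nat_mul]
    rw [← Real.exp_sum, expAffine, ← Real.exp_add]
    congr 1
    rw [add_assoc, ← Finset.sum_add_distrib]
    simp [mul_comm]
  have hsign : ∀ ε : Fin n → ℝ, (∀ i, ε i ^ 2 = 1) →
      0 ≤ expAffine a y β + d * ∏ i, ε i ^ β i := by
    intro ε hε
    have h := hf fun i => ε i * Real.exp (-y i)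
    have hsum : ∑ α ∈ S, c α * ∏ i, (ε i * Real.exp (-y i)) ^ α i = Real.exp a := by
      calc ∑ α ∈ S, c α * ∏ i, (ε i * Real.exp (-y i)) ^ α i
          = ∑ α ∈ S, w α * Real.exp a := by
            refine Finset.sum_congr rfl fun α hα => ?_
            have h1 : ∏ i, ε i ^ α i = 1 := by
              refine Finset.prod_eq_one fun i _ => ?_
              obtain ⟨k, hk⟩ := (hS α hα i).two_dvd
              rw [hk, pow_mul, hε, one_pow]
            simp only [mul_pow, Finset.prod_mul_distrib, h1, one_mul]
            rw [hcw α hα, mul_assoc, hmon]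
        _ = Real.exp a := by rw [← Finset.sum_mul, hw1, one_mul]
    rw [eval_circuitPoly, hsum] at h
    simp only [mul_pow, Finset.prod_mul_distrib] at h
    have hpos : 0 < ∏ i, Real.exp (-y i) ^ β i :=
      Finset.prod_pos fun i _ => pow_pos (Real.exp_pos _) _
    rw [← hmon β] at h
    refine nonneg_of_mul_nonneg_left (b := ∏ i, Real.exp (-y i) ^ β i) ?_ hpos
    linarith
  refine ⟨a, y, hcw, ?_, fun hβ => ?_⟩
  · have := hsign 1 (by simp)
    simp at this
    linarith
  · obtain ⟨j, hj⟩ := not_forall.1 hβ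
    have := hsign (fun i => if i = j then -1 else 1) (fun i => by split_ifs <;> norm_num)
    have hprod : ∏ i, (if i = j then (-1 : ℝ) else 1) ^ β i = -1 := by
      rw [Finset.prod_eq_single j (fun i _ hi => by simp [hi]) (by simp)]
      simp [(Nat.not_even_iff_odd.1 hj).neg_one_pow]
    rw [hprod] at this
    linarith

/-- If each member of a finite family lies in a cone up to a contracting multiple of a member of
the family, then the family lies in the cone. -/
lemma mem_cone_of_contracting {ι V : Type*} [Finite ι] [AddCommGroup V] [Module ℝ V]
    (K : PointedCone ℝ V) (v : ι → V)
    (h : ∀ i, v i ∈ K ∨ ∃ j, ∃ t : ℝ, 0 ≤ t ∧ t < 1 ∧ v i - t • v j ∈ K) (i : ι) : v i ∈ K := by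
  have h' : ∀ i, ∃ j, ∃ t : ℝ, 0 ≤ t ∧ t < 1 ∧ v i - t • v j ∈ K := fun i =>
    (h i).elim (fun hi => ⟨i, 0, le_rfl, one_pos, by simpa using hi⟩) id
  choose g t ht0 ht1 hg using h'
  have hiter : ∀ k i, ∃ T : ℝ, 0 ≤ T ∧ T ≤ 1 ∧ (k ≠ 0 → T < 1) ∧ v i - T • v (g^[k] i) ∈ K := by
    intro k
    induction k with
    | zero => exact fun i => ⟨1, zero_le_one, le_rfl, by simp, by simp⟩
    | succ k ih =>
      intro i
      obtain ⟨T, hT0, hT1, -, hT⟩ := ih (g i)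
      have hlt : t i * T < 1 := (mul_le_of_le_one_right (ht0 i) hT1).trans_lt (ht1 i)
      refine ⟨t i * T, mul_nonneg (ht0 i) hT0, hlt.le, fun _ => hlt, ?_⟩
      · have := K.add_mem (hg i) (PointedCone.smul_mem K (ht0 i) hT)
        rw [Function.iterate_succ_apply]
        convert this using 1
        module
  obtain ⟨m, m', hne, heq⟩ := Finite.exists_ne_map_eq_of_infinite fun k => g^[k] i
  wlog hlt : m < m' generalizing m m'
  · exact this m' m hne.symm heq.symm (lt_of_le_of_ne (not_lt.1 hlt) hne.symm)
  obtain ⟨T, hT0, -, hT1, hT⟩ := hiter (m' - m) (g^[m] i)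
  rw [← Function.iterate_add_apply, Nat.sub_add_cancel hlt.le, ← heq] at hT
  have hT1 : T < 1 := hT1 (Nat.sub_ne_zero_of_lt hlt)
  have hp : v (g^[m] i) ∈ K := by
    have := PointedCone.smul_mem K (inv_nonneg.2 (sub_pos.2 hT1).le) hT
    rwa [show v (g^[m] i) - T • v (g^[m] i) = (1 - T) • v (g^[m] i) by module,
      inv_smul_smul₀ (sub_pos.2 hT1).ne'] at this
  obtain ⟨T', hT0', -, -, hT'⟩ := hiter m i
  have := K.add_mem hT' (PointedCone.smul_mem K hT0' hp)
  rwa [sub_add_cancel] at this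

open Classical in
/-- The even points of `A` in the convex hull of `S`. -/
noncomputable def evenHull {n : ℕ} (A S : Finset (Fin n →₀ ℕ)) : Finset (Fin n →₀ ℕ) :=
  {γ ∈ A | IsEvenPt γ ∧ toR γ ∈ convexHull ℝ (toR '' (S : Set (Fin n →₀ ℕ)))}

/-- Replacing a simplex by one inside it that misses a vertex loses an even point. -/
lemma evenHull_ssubset {n : ℕ} {A S S' : Finset (Fin n →₀ ℕ)} (hSA : S ⊆ A)
    (hS : ∀ α ∈ S, IsEvenPt α)
    (hind : AffineIndependent ℝ (fun α : S => toR (α : Fin n →₀ ℕ)))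
    (hS' : ∀ α ∈ S', toR α ∈ convexHull ℝ (toR '' (S : Set (Fin n →₀ ℕ))))
    {α₀ : Fin n →₀ ℕ} (hα₀ : α₀ ∈ S) (hα₀' : α₀ ∉ S') : evenHull A S' ⊂ evenHull A S := by
  classical
  have hsub : convexHull ℝ (toR '' (S' : Set (Fin n →₀ ℕ))) ⊆
      convexHull ℝ (toR '' (S : Set (Fin n →₀ ℕ))) :=
    convexHull_min (by rintro _ ⟨α, hα, rfl⟩; exact hS' α hα) (convex_convexHull ℝ _)
  refine (Finset.ssubset_iff_of_subset fun γ hγ => ?_).2 ⟨α₀, ?_, fun h => ?_⟩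
  · simp only [evenHull, Finset.mem_filter] at hγ ⊢
    exact ⟨hγ.1, hγ.2.1, hsub hγ.2.2⟩
  · simp only [evenHull, Finset.mem_filter]
    exact ⟨hSA hα₀, hS _ hα₀, subset_convexHull ℝ _ ⟨α₀, hα₀, rfl⟩⟩
  · simp only [evenHull, Finset.mem_filter] at h
    obtain ⟨u, hu0, hu1, hu2⟩ := mem_convexHull_toR_iff.1 h.2.2
    choose! W hW0 hW1 hW2 using fun α (hα : α ∈ S') => mem_convexHull_toR_iff.1 (hS' α hα)
    have hall := barycentric_unique hind (u := fun γ => ∑ α ∈ S', u α * W α γ)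
      (v := fun γ => if γ = α₀ then 1 else 0) ?_ ?_
    · obtain ⟨α, hα, hαu⟩ : ∃ α ∈ S', 0 < u α := by
        by_contra! hcon
        have := Finset.sum_nonpos hcon
        linarith
      have hvert : ∀ γ ∈ S, W α γ = if γ = α₀ then 1 else 0 := by
        have hzero : ∀ γ ∈ S, γ ≠ α₀ → W α γ = 0 := by
          intro γ hγ hne
          have h1 := hall γ hγ
          simp only [hne, if_false] at h1
          have h2 := (Finset.sum_eq_zero_iff_of_nonneg
            fun δ hδ => mul_nonneg (hu0 δ hδ) (hW0 δ hδ γ hγ)).1 h1 α hα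
          exact (mul_eq_zero.1 h2).resolve_left hαu.ne'
        intro γ hγ
        split_ifs with hγα
        · rw [hγα, ← hW1 α hα]
          exact (Finset.sum_eq_single_of_mem α₀ hα₀ fun δ hδ hne => hzero δ hδ hne).symm
        · exact hzero γ hγ hγα
      refine hα₀' ?_
      convert hα using 1
      ext i
      have h3 := hW2 α hα i
      rw [Finset.sum_congr rfl fun γ hγ => by rw [hvert γ hγ]] at h3
      simp only [ite_mul, one_mul, zero_mul, Finset.sum_ite_eq', hα₀, if_true, toR] at h3
      exact_mod_cast h3.symm
    · rw [Finset.sum_comm]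
      simp only [← Finset.mul_sum]
      rw [Finset.sum_congr rfl fun α hα => by rw [hW1 α hα, mul_one], hu1]
      simp [hα₀]
    · intro i
      have h1 : ∑ γ ∈ S, (∑ α ∈ S', u α * W α γ) * (γ i : ℝ) = ∑ α ∈ S', u α * (α i : ℝ) := by
        simp only [Finset.sum_mul]
        rw [Finset.sum_comm]
        refine Finset.sum_congr rfl fun α hα => ?_
        rw [show (α i : ℝ) = _ from hW2 α hα i, Finset.mul_sum]
        exact Finset.sum_congr rfl fun _ _ => by ring
      rw [h1, ← hu2]
      simp [hα₀, toR]

/-- A non-reduced circuit contains an even point other than its vertices and its inner point. -/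
lemma exists_even_of_not_reduced {n : ℕ} {A S : Finset (Fin n →₀ ℕ)} {β : Fin n →₀ ℕ}
    (hC : IsCircuitOn A S β) (hnr : ¬ IsReducedCircuitOn A S β) :
    ∃ γ ∈ A, IsEvenPt γ ∧ γ ∉ S ∧ γ ≠ β ∧
      toR γ ∈ convexHull ℝ (toR '' (S : Set (Fin n →₀ ℕ))) := by
  by_contra! hcon
  refine hnr ⟨hC, Set.ext fun γ => ⟨fun ⟨hA, he, hm⟩ => ⟨?_, he⟩, fun ⟨h, he⟩ => ?_⟩⟩
  · by_contra! h
    exact hcon γ hA he h.1 h.2 hm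
  · rcases h with h | rfl
    · exact ⟨hC.subset h, he, subset_convexHull ℝ _ ⟨γ, h, rfl⟩⟩
    · exact ⟨hC.beta_mem, he, intrinsicInterior_subset hC.relint⟩

/-- Splitting a non-reduced circuit at an even point `γ`: the first part is a circuit with the
same inner point and smaller hull, the second one has inner point `γ` and is contracted. -/
lemma exists_split {n : ℕ} {A S : Finset (Fin n →₀ ℕ)} {β : Fin n →₀ ℕ}
    {w : (Fin n →₀ ℕ) → ℝ} (hC : IsCircuitOn A S β) (hw : IsBarycentric S β w)
    (hnr : ¬ IsReducedCircuitOn A S β) :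
    ∃ (S₁ S₂ : Finset (Fin n →₀ ℕ)) (γ : Fin n →₀ ℕ) (w₁ μ : (Fin n →₀ ℕ) → ℝ) (t : ℝ),
      0 ≤ t ∧ t < 1 ∧ IsCircuitOn A S₁ β ∧ IsBarycentric S₁ β w₁ ∧ IsCircuitOn A S₂ γ ∧
      IsBarycentric S₂ γ μ ∧ evenHull A S₁ ⊂ evenHull A S ∧
      (S₂ = S ∨ evenHull A S₂ ⊂ evenHull A S) ∧
      ∀ a y σ, agmPoly a y S β w σ = agmPoly a y S₁ β w₁ σ + t • agmPoly a y S₂ γ μ (-1) := by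
  classical
  obtain ⟨γ, hγA, hγe, hγS, hγβ, hγ⟩ := exists_even_of_not_reduced hC hnr
  obtain ⟨μ, hμ0, hμ1, hμ2⟩ := mem_convexHull_toR_iff.1 hγ
  obtain ⟨hw0, hw1, hw2⟩ := hw
  let S₂ := {α ∈ S | 0 < μ α}
  have hS₂ : ∀ α ∈ S, α ∉ S₂ → μ α = 0 := fun α hα h =>
    le_antisymm (not_lt.1 fun h' => h (Finset.mem_filter.2 ⟨hα, h'⟩)) (hμ0 α hα)
  have hS₂S : S₂ ⊆ S := Finset.filter_subset _ _
  have hne : S₂.Nonempty := by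
    by_contra hcon
    have hz : ∑ α ∈ S, μ α = 0 := Finset.sum_eq_zero fun α hα => hS₂ α hα fun h => hcon ⟨α, h⟩
    linarith
  obtain ⟨α₀, hα₀, hmin⟩ := S₂.exists_min_image (fun α => w α / μ α) hne
  have hα₀S : α₀ ∈ S := hS₂S hα₀
  have hμα₀ : 0 < μ α₀ := (Finset.mem_filter.1 hα₀).2
  set t := w α₀ / μ α₀ with ht
  have ht0 : 0 < t := div_pos (hw0 _ hα₀S) hμα₀
  have hdiff : ∀ α ∈ S, 0 ≤ w α - t * μ α := by
    intro α hα
    by_cases h : α ∈ S₂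
    · have := (le_div_iff₀ (Finset.mem_filter.1 h).2).1 (hmin α h)
      linarith
    · rw [hS₂ α hα h]
      linarith [hw0 α hα]
  have hdiff₀ : w α₀ - t * μ α₀ = 0 := by
    rw [ht, div_mul_cancel₀ _ hμα₀.ne', sub_self]
  have hsum : ∑ α ∈ S, (w α - t * μ α) = 1 - t := by
    rw [Finset.sum_sub_distrib, ← Finset.mul_sum, hw1, hμ1, mul_one]
  have ht1 : t < 1 := by
    refine lt_of_le_of_ne (by linarith [Finset.sum_nonneg hdiff]) fun h => hγβ ?_
    rw [h, sub_self, Finset.sum_eq_zero_iff_of_nonneg (by rwa [h] at hdiff)] at hsum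
    ext i
    have h1 : (γ i : ℝ) = β i := by
      rw [hw2, show (γ i : ℝ) = _ from hμ2 i]
      refine Finset.sum_congr rfl fun α hα => ?_
      have := hsum α hα
      rw [show μ α = w α by linarith]
    exact_mod_cast h1
  let S' := {α ∈ S | 0 < w α - t * μ α}
  have hS' : ∀ α ∈ S, α ∉ S' → w α - t * μ α = 0 := fun α hα h =>
    le_antisymm (not_lt.1 fun h' => h (Finset.mem_filter.2 ⟨hα, h'⟩)) (hdiff α hα)
  have hS'S : S' ⊆ S := Finset.filter_subset _ _
  have hα₀S' : α₀ ∉ S' := fun h => (Finset.mem_filter.1 h).2.ne' hdiff₀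
  have hγS' : γ ∉ S' := fun h => hγS (hS'S h)
  let w₁ : (Fin n →₀ ℕ) → ℝ := fun α => if α = γ then t else w α - t * μ α
  have hw₁ : ∀ α ∈ S', w₁ α = w α - t * μ α := fun α hα =>
    if_neg fun h : α = γ => hγS' (h ▸ hα)
  have hw₁γ : w₁ γ = t := if_pos rfl
  have hsumS' : ∀ F : (Fin n →₀ ℕ) → ℝ,
      ∑ α ∈ insert γ S', w₁ α * F α = t * F γ + ∑ α ∈ S, (w α - t * μ α) * F α := by
    intro F
    rw [Finset.sum_insert hγS', hw₁γ]
    congr 1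
    rw [← Finset.sum_subset hS'S fun α hα h => by rw [hS' α hα h, zero_mul]]
    exact Finset.sum_congr rfl fun α hα => by rw [hw₁ α hα]
  have hbary₁ : IsBarycentric (insert γ S') β w₁ := by
    refine ⟨fun α hα => ?_, ?_, fun i => ?_⟩
    · rcases Finset.mem_insert.1 hα with rfl | h
      · rwa [hw₁γ]
      · rw [hw₁ α h]
        exact (Finset.mem_filter.1 h).2
    · have := hsumS' fun _ => 1
      simp only [mul_one] at this
      rw [this, hsum]
      ring
    · rw [hsumS' fun α => (α i : ℝ), hw2, show (γ i : ℝ) = _ from hμ2 i, Finset.mul_sum,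
        ← Finset.sum_add_distrib]
      exact Finset.sum_congr rfl fun _ _ => by ring
  have hsumS₂ : ∀ F : (Fin n →₀ ℕ) → ℝ, ∑ α ∈ S₂, μ α * F α = ∑ α ∈ S, μ α * F α := fun F =>
    Finset.sum_subset hS₂S fun α hα h => by rw [hS₂ α hα h, zero_mul]
  have hbary₂ : IsBarycentric S₂ γ μ := by
    refine ⟨fun α hα => (Finset.mem_filter.1 hα).2, ?_, fun i => ?_⟩
    · simpa [hμ1] using hsumS₂ fun _ => 1
    · rw [hsumS₂]
      exact hμ2 i
  have hind₂ : AffineIndependent ℝ (fun α : S₂ => toR (α : Fin n →₀ ℕ)) :=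
    hC.indep.comp_embedding ⟨fun α : S₂ => (⟨α, hS₂S α.2⟩ : S), fun a b h => by
      exact Subtype.ext (congrArg (fun c : S => (c : Fin n →₀ ℕ)) h)⟩
  have hind₁ : AffineIndependent ℝ
      (fun α : (insert γ S' : Finset (Fin n →₀ ℕ)) => toR (α : Fin n →₀ ℕ)) := by
    rw [affineIndependent_toR_iff]
    intro u hu1 hu2
    rw [Finset.sum_insert hγS'] at hu1
    simp only [Finset.sum_insert hγS'] at hu2
    have hext : ∀ F : (Fin n →₀ ℕ) → ℝ,
        ∑ α ∈ S, (if α ∈ S' then u α else 0) * F α = ∑ α ∈ S', u α * F α := by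
      intro F
      rw [← Finset.sum_subset hS'S fun α _ h => by rw [if_neg h, zero_mul]]
      exact Finset.sum_congr rfl fun α hα => by rw [if_pos hα]
    have hall := affineIndependent_toR_iff.1 hC.indep
      (fun α => (if α ∈ S' then u α else 0) + u γ * μ α) ?_ ?_
    · have hγ0 : u γ = 0 := by
        have := hall α₀ hα₀S
        rw [if_neg hα₀S', zero_add] at this
        exact (mul_eq_zero.1 this).resolve_right hμα₀.ne'
      intro α hα
      rcases Finset.mem_insert.1 hα with rfl | h
      · exact hγ0
      · have := hall α (hS'S h)
        rwa [if_pos h, hγ0, zero_mul, add_zero] at this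
    · have := hext fun _ => 1
      simp only [mul_one] at this
      rw [Finset.sum_add_distrib, this, ← Finset.mul_sum, hμ1]
      linarith
    · intro i
      simp only [add_mul, Finset.sum_add_distrib]
      rw [hext fun α => (α i : ℝ), ← hu2 i, show (γ i : ℝ) = _ from hμ2 i, Finset.mul_sum,
        add_comm]
      simp only [mul_assoc]
  refine ⟨insert γ S', S₂, γ, w₁, μ, t, ht0.le, ht1, ?_, hbary₁, ?_, hbary₂, ?_, ?_, ?_⟩
  · refine ⟨Finset.insert_subset hγA (hS'S.trans hC.subset), fun α hα => ?_, hC.beta_mem, hind₁,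
      (mem_intrinsicInterior_iff hind₁ β).2 ⟨w₁, hbary₁⟩⟩
    rcases Finset.mem_insert.1 hα with rfl | h
    · exact hγe
    · exact hC.even_mem α (hS'S h)
  · exact ⟨hS₂S.trans hC.subset, fun α hα => hC.even_mem α (hS₂S hα), hγA, hind₂,
      (mem_intrinsicInterior_iff hind₂ γ).2 ⟨μ, hbary₂⟩⟩
  · refine evenHull_ssubset hC.subset hC.even_mem hC.indep (fun α hα => ?_) hα₀S ?_
    · rcases Finset.mem_insert.1 hα with rfl | h
      · exact hγ
      · exact subset_convexHull ℝ _ ⟨α, hS'S h, rfl⟩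
    · rw [Finset.mem_insert, not_or]
      exact ⟨fun h => hγS (h ▸ hα₀S), hα₀S'⟩
  · by_cases h : S₂ = S
    · exact Or.inl h
    · obtain ⟨α, hα, hα'⟩ := Finset.exists_of_ssubset (hS₂S.ssubset_of_ne h)
      exact Or.inr <| evenHull_ssubset hC.subset hC.even_mem hC.indep
        (fun δ hδ => subset_convexHull ℝ _ ⟨δ, hS₂S hδ, rfl⟩) hα hα'
  · intro a y σ
    have h1 : ∑ α ∈ S', monomial α (w₁ α * expAffine a y α) =
        ∑ α ∈ S, monomial α ((w α - t * μ α) * expAffine a y α) := by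
      rw [← Finset.sum_subset hS'S fun α hα h => by rw [hS' α hα h, zero_mul, monomial_zero]]
      exact Finset.sum_congr rfl fun α hα => by rw [hw₁ α hα]
    have h2 : ∑ α ∈ S₂, monomial α (μ α * expAffine a y α) =
        ∑ α ∈ S, monomial α (μ α * expAffine a y α) :=
      Finset.sum_subset hS₂S fun α hα h => by rw [hS₂ α hα h, zero_mul, monomial_zero]
    have h3 : ∑ α ∈ S, monomial α (w α * expAffine a y α) =
        ∑ α ∈ S, monomial α ((w α - t * μ α) * expAffine a y α) +
          t • ∑ α ∈ S, monomial α (μ α * expAffine a y α) := by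
      rw [Finset.smul_sum, ← Finset.sum_add_distrib]
      refine Finset.sum_congr rfl fun α _ => ?_
      rw [smul_monomial, ← map_add, smul_eq_mul]
      congr 1
      ring
    have h4 : monomial γ (t * expAffine a y γ) + t • monomial γ (-1 * expAffine a y γ) = 0 := by
      rw [smul_monomial, ← map_add, smul_eq_mul,
        show t * expAffine a y γ + t * (-1 * expAffine a y γ) = 0 by ring, map_zero]
    simp only [agmPoly, circuitPoly]
    rw [Finset.sum_insert hγS', hw₁γ, h1, h2, h3, smul_add]
    linear_combination -h4

/-- The convex cone generated by the reduced generators. -/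
noncomputable def reducedCone {n : ℕ} (A : Finset (Fin n →₀ ℕ)) :
    PointedCone ℝ (MvPolynomial (Fin n) ℝ) :=
  Submodule.span {c : ℝ // 0 ≤ c} (SONCGenReduced A)

lemma monomial_mem_reducedCone {n : ℕ} {A : Finset (Fin n →₀ ℕ)} {α : Fin n →₀ ℕ} (hα : α ∈ A)
    (he : IsEvenPt α) {c : ℝ} (hc : 0 ≤ c) : monomial α c ∈ reducedCone A := by
  have h : monomial α (1 : ℝ) ∈ reducedCone A :=
    Submodule.subset_span (Or.inr ⟨α, hα, he, rfl⟩)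
  simpa [smul_monomial] using PointedCone.smul_mem _ hc h

lemma agmPoly_mem_reducedCone {n : ℕ} {A : Finset (Fin n →₀ ℕ)} (a : ℝ) (y : Fin n → ℝ)
    {S : Finset (Fin n →₀ ℕ)} {β : Fin n →₀ ℕ} {w : (Fin n →₀ ℕ) → ℝ} {σ : ℝ}
    (hC : IsCircuitOn A S β) (hw : IsBarycentric S β w) (hσ : |σ| ≤ 1) :
    agmPoly a y S β w σ ∈ reducedCone A := by
  induction hT : evenHull A S using Finset.strongInduction generalizing S β w σ with
  | H T ih =>
    subst hT
    have step : ∀ {β w σ}, IsCircuitOn A S β → IsBarycentric S β w → |σ| ≤ 1 →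
        agmPoly a y S β w σ ∈ reducedCone A ∨ ∃ γ μ t, 0 ≤ t ∧ t < 1 ∧ IsCircuitOn A S γ ∧
          IsBarycentric S γ μ ∧
          agmPoly a y S β w σ - (t : ℝ) • agmPoly a y S γ μ (-1) ∈ reducedCone A := by
      intro β w σ hC hw hσ
      by_cases hr : IsReducedCircuitOn A S β
      · refine Or.inl (Submodule.subset_span (Or.inl ⟨S, β, _, _, hr, fun α hα => ?_, rfl,
          agmPoly_nonneg a y hC.even_mem hw hσ⟩))
        exact mul_pos (hw.1 α hα) (expAffine_pos a y α)
      · obtain ⟨S₁, S₂, γ, w₁, μ, t, ht0, ht1, hC₁, hw₁, hC₂, hμ, hT₁, hT₂, hsplit⟩ :=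
          exists_split hC hw hr
        have h₁ := ih _ hT₁ hC₁ hw₁ hσ rfl
        rcases hT₂ with rfl | hT₂
        · refine Or.inr ⟨γ, μ, t, ht0, ht1, hC₂, hμ, ?_⟩
          rwa [hsplit, add_sub_cancel_right]
        · left
          rw [hsplit]
          exact add_mem h₁ (PointedCone.smul_mem _ ht0 (ih _ hT₂ hC₂ hμ (by simp) rfl))
    choose W hW using fun β : {β : A // IsCircuitOn A S β} =>
      (mem_intrinsicInterior_iff β.2.indep β.1).1 β.2.relint
    have hinner := mem_cone_of_contracting (reducedCone A)
      (fun β : {β : A // IsCircuitOn A S β} => agmPoly a y S β.1 (W β) (-1)) fun β =>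
        (step β.2 (hW β) (by simp)).imp_right fun ⟨γ, μ, t, ht0, ht1, hγ, hμ, h⟩ => by
          refine ⟨⟨⟨γ, hγ.beta_mem⟩, hγ⟩, t, ht0, ht1, ?_⟩
          have hWγ := hW ⟨⟨γ, hγ.beta_mem⟩, hγ⟩
          rwa [agmPoly_congr (barycentric_unique hγ.indep (hμ.2.1.trans hWγ.2.1.symm)
            fun i => (hμ.2.2 i).symm.trans (hWγ.2.2 i))] at h
    rcases step hC hw hσ with h | ⟨γ, μ, t, ht0, -, hγ, hμ, h⟩
    · exact h
    · have hWγ := hW ⟨⟨γ, hγ.beta_mem⟩, hγ⟩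
      have h' := hinner ⟨⟨γ, hγ.beta_mem⟩, hγ⟩
      simp only at h'
      rw [← agmPoly_congr (barycentric_unique hγ.indep (hμ.2.1.trans hWγ.2.1.symm)
        fun i => (hμ.2.2 i).symm.trans (hWγ.2.2 i))] at h'
      have := add_mem h (PointedCone.smul_mem _ ht0 h')
      rwa [sub_add_cancel] at this

lemma SONCGen_subset_reducedCone {n : ℕ} (A : Finset (Fin n →₀ ℕ)) :
    SONCGen A ⊆ reducedCone A := by
  rintro f (⟨S, β, c, d, hC, hc, rfl, hf⟩ | ⟨α, hα, he, rfl⟩)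
  · obtain ⟨w, hw⟩ := (mem_intrinsicInterior_iff hC.indep β).1 hC.relint
    obtain ⟨a, y, hcw, hd, hd'⟩ := exists_expAffine_of_nonneg hC.even_mem hC.indep hw hc hf
    by_cases hdE : d ≤ expAffine a y β
    · have hE := expAffine_pos a y β
      have h := agmPoly_mem_reducedCone a y (σ := d / expAffine a y β) hC hw
        (by rw [abs_div, abs_of_pos hE, div_le_one hE, abs_le]; exact ⟨hd, hdE⟩)
      have heq : circuitPoly S β c d = agmPoly a y S β w (d / expAffine a y β) := by
        rw [agmPoly, div_mul_cancel₀ _ hE.ne']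
        unfold circuitPoly
        congr 1
        exact Finset.sum_congr rfl fun α hα => by rw [hcw α hα]
      rw [heq]
      exact h
    · have hβ : IsEvenPt β := by_contra fun h => hdE (hd' h)
      exact add_mem (sum_mem fun α hα =>
          monomial_mem_reducedCone (hC.subset hα) (hC.even_mem α hα) (hc α hα).le)
        (monomial_mem_reducedCone hC.beta_mem hβ
          ((expAffine_pos a y β).le.trans (not_le.1 hdE).le))
  · exact monomial_mem_reducedCone hα he zero_le_one

/-- **Reduced decomposition of SONC polynomials.** Every polynomial in the SONC cone
on `A` is a finite nonnegative combination of nonnegative circuit polynomials on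
reduced circuits on `A` and monomial squares. -/
theorem sonc_reduced_decomposition {n : ℕ} (A : Finset (Fin n →₀ ℕ))
    (f : MvPolynomial (Fin n) ℝ) (hf : f ∈ SONCCone A) :
    ∃ (k : ℕ) (g : Fin k → MvPolynomial (Fin n) ℝ) (μ : Fin k → ℝ),
      (∀ i, g i ∈ SONCGenReduced A ∧ 0 ≤ μ i) ∧ f = ∑ i, μ i • g i := by
  obtain ⟨k, g, μ, hg, rfl⟩ := hf
  have hmem : ∑ i, μ i • g i ∈ reducedCone A := sum_mem fun i _ =>
    PointedCone.smul_mem _ (hg i).2 (SONCGen_subset_reducedCone A (hg i).1)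
  obtain ⟨m, c, h, hsum⟩ := Submodule.mem_span_set'.1 hmem
  exact ⟨m, fun i => h i, fun i => c i, fun i => ⟨(h i).2, (c i).2⟩, hsum.symm⟩
end
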